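/- arXiv:2004.00174 — 2 statements merged into one kernel-verified Lean document; each statement's English description precedes it below -/
import Mathlib

section
/- Suppose Turing equivalence ≡_T on 2^ω is hyper-recursively-finite. Then many-one equivalence ≡_m on 2^ω and one-one equivalence ≡₁ on 2^ω are universal countable Borel equivalence relations: for every countable Borel equivalence relation E on a standard Borel space X there is an injective Borel function g : X → 2^ω such that for all x_0, x_1 ∈ X, x_0 E x_1 if and only if g(x_0) ≡_m g(x_1), if and only if g(x_0) ≡₁ g(x_1). -/
open scoped Classical

namespace SlamanSteel

/-- Partial recursive functions relative to an oracle `O : ℕ → ℕ`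
(Mathlib's `Nat.Partrec` with an extra oracle clause). -/
inductive RecursiveIn (O : ℕ → ℕ) : (ℕ →. ℕ) → Prop
  | zero : RecursiveIn O (pure 0)
  | succ : RecursiveIn O fun n : ℕ => Part.some (Nat.succ n)
  | left : RecursiveIn O fun n : ℕ => Part.some (Nat.unpair n).1
  | right : RecursiveIn O fun n : ℕ => Part.some (Nat.unpair n).2
  | oracle : RecursiveIn O fun n : ℕ => Part.some (O n)
  | pair {f g : ℕ →. ℕ} : RecursiveIn O f → RecursiveIn O g →
      RecursiveIn O fun n => Nat.pair <$> f n <*> g n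
  | comp {f g : ℕ →. ℕ} : RecursiveIn O f → RecursiveIn O g →
      RecursiveIn O fun n => g n >>= f
  | prec {f g : ℕ →. ℕ} : RecursiveIn O f → RecursiveIn O g →
      RecursiveIn O (Nat.unpaired fun a n =>
        n.rec (f a) fun y IH => do { let i ← IH; g (Nat.pair a (Nat.pair y i)) })
  | rfind {f : ℕ →. ℕ} : RecursiveIn O f →
      RecursiveIn O fun a => Nat.rfind fun n => (fun m => m = 0) <$> f (Nat.pair a n)

/-- The oracle (as a function `ℕ → ℕ`) associated to a real `x ∈ 2^ω`. -/
def oracleOf (x : ℕ → Bool) : ℕ → ℕ := fun n => cond (x n) 1 0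

/-- `z ≤_T x` : `z` is computable relative to the oracle `x`. -/
def TuringLE (z x : ℕ → Bool) : Prop :=
  RecursiveIn (oracleOf x) fun n => Part.some (oracleOf z n)

/-- Turing equivalence on `2^ω`. -/
def TuringEquiv (x y : ℕ → Bool) : Prop := TuringLE x y ∧ TuringLE y x

/-- The `j`th column of `y ∈ 2^ω`. -/
def column (y : ℕ → Bool) (j : ℕ) : ℕ → Bool := fun m => y (Nat.pair j m)

/-- `x ≤_m y` : many-one reducibility on `2^ω`. -/
def MLE (x y : ℕ → Bool) : Prop :=
  ∃ ρ : ℕ → ℕ, Computable ρ ∧ ∀ n, x n = y (ρ n)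

/-- `x ≡_m y` : many-one equivalence on `2^ω`. -/
def MEquiv (x y : ℕ → Bool) : Prop := MLE x y ∧ MLE y x

/-- `x ≤₁ y` : one-one reducibility on `2^ω`. -/
def OneLE (x y : ℕ → Bool) : Prop :=
  ∃ ρ : ℕ → ℕ, Computable ρ ∧ Function.Injective ρ ∧ ∀ n, x n = y (ρ n)

/-- `x ≡₁ y` : one-one equivalence on `2^ω`. -/
def OneEquiv (x y : ℕ → Bool) : Prop := OneLE x y ∧ OneLE y x

/-- The complement `x̄` of a real, flipping every bit. -/
def flipBits (x : ℕ → Bool) : ℕ → Bool := fun n => !(x n)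

/-- The computable join `⊕_i z_i` of a sequence of reals: `(⊕_i z_i)(⟨i,m⟩) = z_i(m)`. -/
def joinSeq (z : ℕ → ℕ → Bool) : ℕ → Bool :=
  fun k => z (Nat.unpair k).1 (Nat.unpair k).2

/-- The computable join of finitely many reals. -/
def joinFin {n : ℕ} (z : Fin n → ℕ → Bool) : ℕ → Bool := fun k =>
  if h : (Nat.unpair k).1 < n then z ⟨(Nat.unpair k).1, h⟩ (Nat.unpair k).2 else false

/-- The initial segment of `x` of length `k`, as a binary string. -/
def initSeg (x : ℕ → Bool) (k : ℕ) : List Bool := (List.range k).map x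

/-- `W` is a set of strings which is computably enumerable relative to the oracle `x`. -/
def CEIn (x : ℕ → Bool) (W : Set (List Bool)) : Prop :=
  ∃ f : ℕ →. ℕ, RecursiveIn (oracleOf x) f ∧
    ∀ σ : List Bool, σ ∈ W ↔ (f (Encodable.encode σ)).Dom

/-- `g` is `x`-generic (1-generic relative to `x`). -/
def GenericIn (x g : ℕ → Bool) : Prop :=
  ∀ W : Set (List Bool), CEIn x W →
    ∃ k, initSeg g k ∈ W ∨ ∀ τ : List Bool, initSeg g k <+: τ → τ ∉ W

/-- `g` is 1-generic. -/
def OneGeneric (g : ℕ → Bool) : Prop := GenericIn (fun _ => false) g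

/-- Reals `z 0, …, z (n-1)` are mutually 1-generic if their join is 1-generic. -/
def MutuallyOneGeneric {n : ℕ} (z : Fin n → ℕ → Bool) : Prop := OneGeneric (joinFin z)

/-- `E` is hyper-`(f_i)`-finite: `E` is an increasing union of Borel subequivalence
relations none of which has a class containing an infinite set `{f i x j : j ∈ ω}`. -/
def HyperFinWrt {X : Type*} [MeasurableSpace X] (E : X → X → Prop)
    (f : ℕ → X → ℕ → X) : Prop :=
  ∃ F : ℕ → X → X → Prop,
    (∀ n, Equivalence (F n)) ∧
    (∀ n, MeasurableSet {p : X × X | F n p.1 p.2}) ∧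
    (∀ n a b, F n a b → F (n + 1) a b) ∧
    (∀ a b, E a b ↔ ∃ n, F n a b) ∧
    (∀ n x i, (Set.range (f i x)).Infinite → ¬ Set.range (f i x) ⊆ {y | F n x y})

/-- `E` is hyper-Borel-finite: hyper-`(f_i)`-finite for every countable sequence of
Borel functions `f_i : X → X^ω`. -/
def HyperBorelFinite {X : Type*} [MeasurableSpace X] (E : X → X → Prop) : Prop :=
  ∀ f : ℕ → X → ℕ → X, (∀ i, Measurable (f i)) → HyperFinWrt E f

/-- Turing equivalence is hyper-recursively-finite: it is an increasing union of Borel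
equivalence relations `F n` such that no `F n`-class of `x` contains, as an infinite
subset, the set of columns of some `y ≤_T x`. -/
def HyperRecFin : Prop :=
  ∃ F : ℕ → (ℕ → Bool) → (ℕ → Bool) → Prop,
    (∀ n, Equivalence (F n)) ∧
    (∀ n, MeasurableSet {p : (ℕ → Bool) × (ℕ → Bool) | F n p.1 p.2}) ∧
    (∀ n a b, F n a b → F (n + 1) a b) ∧
    (∀ a b, TuringEquiv a b ↔ ∃ n, F n a b) ∧
    (∀ n x y, TuringLE y x → (Set.range (column y)).Infinite →
      ¬ Set.range (column y) ⊆ {z | F n x z})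

section LusinNovikov

open MeasureTheory Set Filter Topology TopologicalSpace

/-- A Borel subset of `X × X` all of whose vertical sections have at most one point. -/
def IsBorelGraph {X : Type*} [MeasurableSpace X] (G : Set (X × X)) : Prop :=
  MeasurableSet G ∧ ∀ p ∈ G, ∀ q ∈ G, p.1 = q.1 → p = q

theorem exists_isBorelGraph_of_image {X Q : Type*} [MeasurableSpace X] [StandardBorelSpace X]
    [MeasurableSpace Q] [StandardBorelSpace Q] {ψ : Q → X × X} (hψ : Measurable ψ)
    {C : Set Q} (hC : MeasurableSet C)
    (hg : ∀ c ∈ C, ∀ c' ∈ C, (ψ c).1 = (ψ c').1 → ψ c = ψ c') :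
    ∃ G, IsBorelGraph G ∧ ∀ c ∈ C, ψ c ∈ G := by
  let _ := upgradeStandardBorel X
  obtain ⟨V, hV, hsep⟩ := exists_seq_separating X (p := MeasurableSet)
    MeasurableSet.empty (univ : Set X)
  have hB : ∀ n, ∃ B : Set X, MeasurableSet B ∧
      ∀ c ∈ C, ((ψ c).2 ∈ V n ↔ (ψ c).1 ∈ B) := by
    intro n
    have h1 : AnalyticSet ((fun c => (ψ c).1) '' (C ∩ (fun c => (ψ c).2) ⁻¹' V n)) :=
      (hC.inter (hψ.snd (hV n))).analyticSet_image hψ.fst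
    have h2 : AnalyticSet ((fun c => (ψ c).1) '' (C ∩ (fun c => (ψ c).2) ⁻¹' (V n)ᶜ)) :=
      (hC.inter (hψ.snd (hV n).compl)).analyticSet_image hψ.fst
    have hd : Disjoint ((fun c => (ψ c).1) '' (C ∩ (fun c => (ψ c).2) ⁻¹' V n))
        ((fun c => (ψ c).1) '' (C ∩ (fun c => (ψ c).2) ⁻¹' (V n)ᶜ)) := by
      rw [Set.disjoint_left]
      rintro x ⟨c, ⟨hc, hcV⟩, rfl⟩ ⟨c', ⟨hc', hcV'⟩, he⟩
      apply hcV'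
      have := hg c' hc' c hc he
      simp only [mem_preimage] at hcV ⊢
      rw [this]; exact hcV
    obtain ⟨B, hB1, hB2, hB3⟩ := h1.measurablySeparable h2 hd
    refine ⟨B, hB3, fun c hc => ⟨fun h => hB1 ⟨c, ⟨hc, h⟩, rfl⟩, fun h => ?_⟩⟩
    by_contra hn
    exact (Set.disjoint_left.1 hB2) ⟨c, ⟨hc, hn⟩, rfl⟩ h
  choose B hBm hBc using hB
  refine ⟨{p | ∀ n, p.2 ∈ V n ↔ p.1 ∈ B n}, ⟨?_, ?_⟩, fun c hc n => hBc n c hc⟩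
  · rw [ofPred_forall]
    refine MeasurableSet.iInter fun n => ?_
    have e : {p : X × X | p.2 ∈ V n ↔ p.1 ∈ B n} =
      ((Prod.snd ⁻¹' V n) ∩ (Prod.fst ⁻¹' B n)) ∪
      ((Prod.snd ⁻¹' V n)ᶜ ∩ (Prod.fst ⁻¹' B n)ᶜ) := by
      ext p; simp only [mem_ofPred_eq, mem_union, mem_inter_iff, mem_preimage, mem_compl_iff]; tauto
    rw [e]
    have a : MeasurableSet (Prod.snd ⁻¹' V n : Set (X × X)) := measurable_snd (hV n)
    have b : MeasurableSet (Prod.fst ⁻¹' B n : Set (X × X)) := measurable_fst (hBm n)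
    exact (a.inter b).union (a.compl.inter b.compl)
  · intro p hp q hq h
    refine Prod.ext h (hsep _ trivial _ trivial fun n => ?_)
    rw [hp n, hq n, h]

/-- A set of sequences in `P` whose `φ`-images cannot be met by countably many Borel graphs. -/
def Large {X P : Type*} [MeasurableSpace X] (φ : P → X × X) (B : Set (ℕ → P)) : Prop :=
  ∀ 𝒢 : Set (Set (X × X)), 𝒢.Countable → (∀ G ∈ 𝒢, IsBorelGraph G) →
    ∃ z ∈ B, ∀ i, ∀ G ∈ 𝒢, φ (z i) ∉ G

theorem Large.exists_of_iUnion {X P ι : Type*} [MeasurableSpace X] [Countable ι]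
    {φ : P → X × X} {B : Set (ℕ → P)} (hB : Large φ B) (C : ι → Set (ℕ → P))
    (hC : ∀ z ∈ B, ∃ i, z ∈ C i) : ∃ i, Large φ (C i) := by
  by_contra! hcon
  have : ∀ i, ∃ 𝒢 : Set (Set (X × X)), 𝒢.Countable ∧ (∀ G ∈ 𝒢, IsBorelGraph G) ∧
    ∀ z ∈ C i, ∃ k, ∃ G ∈ 𝒢, φ (z k) ∈ G := by
    intro i
    have := hcon i
    unfold Large at this
    push Not at this
    exact this
  choose 𝒢 h1 h2 h3 using this
  obtain ⟨z, hz, ha⟩ := hB (⋃ i, 𝒢 i) (countable_iUnion h1)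
    (by intro G hG; obtain ⟨i, hi⟩ := mem_iUnion.1 hG; exact h2 i G hi)
  obtain ⟨i, hi⟩ := hC z hz
  obtain ⟨k, G, hG, hk⟩ := h3 i z hi
  exact ha k G (mem_iUnion.2 ⟨i, hG⟩) hk

/-- The sets of sequences used in the proof of Lusin-Novikov uniformization: the coordinates
beyond `n` may be changed freely as long as the first coordinate of the image is kept. -/
structure IsScheme {X P : Type*} [MeasurableSpace X] [MeasurableSpace P]
    (φ : P → X × X) (n : ℕ) (B : Set (ℕ → P)) : Prop where
  meas : MeasurableSet B
  large : Large φ B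
  same : ∀ z ∈ B, ∀ i, (φ (z i)).1 = (φ (z 0)).1
  free : ∀ k, n < k → ∀ z ∈ B, ∀ p, (φ p).1 = (φ (z 0)).1 → Function.update z k p ∈ B

variable {X P : Type*} [MetricSpace X] [SecondCountableTopology X] [CompleteSpace X]
  [MeasurableSpace X] [BorelSpace X]
  [MetricSpace P] [SecondCountableTopology P] [CompleteSpace P]
  [MeasurableSpace P] [BorelSpace P] {φ : P → X × X}

theorem IsScheme.large_split (hφ : Continuous φ) {n : ℕ} {B : Set (ℕ → P)}
    (hB : IsScheme φ n B) {j k : ℕ} (hk : n < k) (hjk : j ≠ k) {ε : ℝ}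
    (hε : ∀ z ∈ B, ∀ z' ∈ B, dist (z j) (z' j) ≤ ε) :
    Large φ {z ∈ B | φ (z j) ≠ φ (z k) ∧ dist (z j) (z k) ≤ ε} := by
  intro 𝒢 h𝒢 hG
  by_contra! hcon
  set C : Set (ℕ → P) := {z ∈ B | ∀ i, ∀ G ∈ 𝒢, φ (z i) ∉ G} with hC
  have hCm : MeasurableSet C := by
    have e : C = B ∩ ⋂ i, ⋂ G ∈ 𝒢, ((fun z : ℕ → P => φ (z i)) ⁻¹' G)ᶜ := by
      ext z; simp [hC]
    rw [e]
    refine hB.meas.inter (MeasurableSet.iInter fun i => MeasurableSet.biInter h𝒢 fun G hGm => ?_)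
    exact ((hφ.measurable.comp (measurable_pi_apply i)) (hG G hGm).1).compl
  obtain ⟨G, hGg, hGC⟩ := exists_isBorelGraph_of_image (ψ := fun z : ℕ → P => φ (z j))
    (hφ.measurable.comp (measurable_pi_apply j)) hCm (by
      rintro z ⟨hz, hza⟩ z' ⟨hz', hza'⟩ h
      by_contra hne
      have hu : Function.update z k (z' j) ∈ B :=
        hB.free k hk z hz _ (h.symm.trans (hB.same z hz j))
      obtain ⟨i, G, hG1, hG2⟩ := hcon (Function.update z k (z' j))
        ⟨hu, by simpa [Function.update_of_ne hjk] using hne, by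
          simpa [Function.update_of_ne hjk] using hε z hz z' hz'⟩
      by_cases hik : i = k
      · subst hik; rw [Function.update_self] at hG2; exact hza' j G hG1 hG2
      · rw [Function.update_of_ne hik] at hG2; exact hza i G hG1 hG2)
  obtain ⟨z, hz, hza⟩ := hB.large (insert G 𝒢) (h𝒢.insert G) (by
    rintro G' (rfl | h)
    · exact hGg
    · exact hG _ h)
  exact hza j G (mem_insert _ _) (hGC z ⟨hz, fun i G' h => hza i G' (mem_insert_of_mem _ h)⟩)

theorem IsScheme.exists_refine (hφ : Continuous φ) [Nonempty P] {n : ℕ} {B : Set (ℕ → P)}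
    (hB : IsScheme φ n B) {j : ℕ} (hj : j ≤ n) {ε : ℝ} (hε : 0 < ε) :
    ∃ B' ⊆ B, IsScheme φ (n + 1) B' ∧
      (∀ z ∈ B', ∀ z' ∈ B', ∀ i ≤ n, dist (z i) (z' i) ≤ ε) ∧
      (∀ z ∈ B', dist (z j) (z (n + 1)) ≤ ε) ∧
      ∃ δ > 0, ∀ z ∈ B', δ ≤ dist (φ (z j)) (φ (z (n + 1))) := by
  have hc : ∀ i, Measurable fun z : ℕ → P => z i := fun i => measurable_pi_apply i
  let D : (Fin (n + 1) → ℕ) → Set (ℕ → P) := fun c =>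
    {z ∈ B | ∀ i : Fin (n + 1), dist (z i) (denseSeq P (c i)) ≤ ε / 2}
  obtain ⟨c, hcL⟩ := hB.large.exists_of_iUnion D (by
    intro z hz
    have : ∀ i : Fin (n + 1), ∃ m, dist (z i) (denseSeq P m) ≤ ε / 2 := fun i => by
      obtain ⟨m, hm⟩ := (denseRange_denseSeq P).exists_dist_lt (z i) (half_pos hε)
      exact ⟨m, hm.le⟩
    choose c hc using this
    exact ⟨c, hz, hc⟩)
  have hDm : MeasurableSet (D c) := by
    have e : D c = B ∩ ⋂ i : Fin (n + 1), {z : ℕ → P | dist (z i) (denseSeq P (c i)) ≤ ε / 2} := by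
      ext z; simp [D]
    rw [e]
    exact hB.meas.inter (MeasurableSet.iInter fun i =>
      measurableSet_le ((hc i).dist measurable_const) measurable_const)
  have hD : IsScheme φ n (D c) := by
    refine ⟨hDm, hcL, fun z hz => hB.same z hz.1, fun k hk z hz p hp =>
      ⟨hB.free k hk z hz.1 p hp, fun i => ?_⟩⟩
    have : (i : ℕ) ≠ k := by have := i.2; omega
    rw [Function.update_of_ne this]
    exact hz.2 i
  have hDd : ∀ z ∈ D c, ∀ z' ∈ D c, ∀ i ≤ n, dist (z i) (z' i) ≤ ε := by
    intro z hz z' hz' i hi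
    have h1 := hz.2 ⟨i, by omega⟩
    have h2 := hz'.2 ⟨i, by omega⟩
    have := dist_triangle_right (z i) (z' i) (denseSeq P (c ⟨i, by omega⟩))
    simp only at h1 h2
    linarith
  have hS := hD.large_split hφ (j := j) (k := n + 1) (by omega) (by omega)
    (fun z hz z' hz' => hDd z hz z' hz' j hj)
  obtain ⟨m, hm⟩ := hS.exists_of_iUnion (fun m : ℕ => {z ∈ D c | dist (z j) (z (n + 1)) ≤ ε ∧
      1 / ((m : ℝ) + 1) ≤ dist (φ (z j)) (φ (z (n + 1)))}) (by
    rintro z ⟨hz, hne, hd⟩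
    obtain ⟨m, hm⟩ := exists_nat_one_div_lt (dist_pos.2 hne)
    exact ⟨m, hz, hd, hm.le⟩)
  refine ⟨_, fun z hz => hz.1.1, ⟨?_, hm, fun z hz => hB.same z hz.1.1, ?_⟩,
    fun z hz z' hz' => hDd z hz.1 z' hz'.1, fun z hz => hz.2.1, _, Nat.one_div_pos_of_nat,
    fun z hz => hz.2.2⟩
  · have m1 := measurableSet_le ((hc j).dist (hc (n + 1))) (measurable_const (a := ε))
    have m2 := measurableSet_le (measurable_const (a := 1 / ((m : ℝ) + 1)))
      ((hφ.measurable.comp (hc j)).dist (hφ.measurable.comp (hc (n + 1))))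
    exact hDm.inter (m1.inter m2)
  · intro k hk z hz p hp
    refine ⟨hD.free k (by omega) z hz.1 p hp, ?_⟩
    rw [Function.update_of_ne (by omega), Function.update_of_ne (by omega)]
    exact hz.2

theorem exists_countable_isBorelGraph_cover (hφ : Continuous φ) [Nonempty P]
    (hcount : ∀ x, {y | (x, y) ∈ range φ}.Countable) :
    ∃ 𝒢 : Set (Set (X × X)), 𝒢.Countable ∧ (∀ G ∈ 𝒢, IsBorelGraph G) ∧
      ∀ p, ∃ G ∈ 𝒢, φ p ∈ G := by
  by_contra! hcon
  have h0 : IsScheme φ 0 {z : ℕ → P | ∀ i, (φ (z i)).1 = (φ (z 0)).1} := by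
    refine ⟨?_, ?_, fun z hz => hz, ?_⟩
    · rw [ofPred_forall]
      exact MeasurableSet.iInter fun i => measurableSet_eq_fun
        (hφ.fst.measurable.comp (measurable_pi_apply i))
        (hφ.fst.measurable.comp (measurable_pi_apply 0))
    · intro 𝒢 h1 h2
      obtain ⟨p, hp⟩ := hcon 𝒢 h1 h2
      exact ⟨fun _ => p, fun i => rfl, fun i => hp⟩
    · intro k hk z hz p hp i
      rw [Function.update_of_ne (a := 0) (by omega)]
      by_cases hik : i = k
      · subst hik; rwa [Function.update_self]
      · rw [Function.update_of_ne hik]; exact hz i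
  have step := fun (n : ℕ) (b : {B : Set (ℕ → P) // IsScheme φ n B}) =>
    b.2.exists_refine hφ (Nat.unpair_left_le n) (ε := (1 / 2 : ℝ) ^ n) (by positivity)
  choose next hsub hsch hdist hnear hsepar using step
  let B : (n : ℕ) → {B : Set (ℕ → P) // IsScheme φ n B} := fun n =>
    Nat.rec ⟨_, h0⟩ (fun n b => ⟨next n b, hsch n b⟩) n
  have hanti : Antitone fun n => (B n).val :=
    antitone_nat_of_succ_le (f := fun n => (B n).val) fun n => hsub n (B n)
  have hne : ∀ n, ∃ z, z ∈ (B n).val := fun n => by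
    obtain ⟨z, hz, -⟩ := (B n).2.large ∅ countable_empty (by simp)
    exact ⟨z, hz⟩
  choose z hz using hne
  have hzd : ∀ i m n n', i ≤ m → m < n → m < n' → dist (z n i) (z n' i) ≤ (1 / 2 : ℝ) ^ m := by
    intro i m n n' h1 h2 h3
    exact hdist m (B m) _ (hanti (Nat.succ_le_of_lt h2) (hz n)) _
      (hanti (Nat.succ_le_of_lt h3) (hz n')) i h1
  have hcau : ∀ i, ∃ l, Tendsto (fun n => z n i) atTop (𝓝 l) := by
    intro i
    apply cauchySeq_tendsto_of_complete
    rw [Metric.cauchySeq_iff']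
    intro ε hε
    obtain ⟨m, hm⟩ := exists_pow_lt_of_lt_one hε (by norm_num : (1 / 2 : ℝ) < 1)
    refine ⟨max i m + 1, fun n hn => (hzd i (max i m) _ _ (le_max_left _ _) (by omega)
      (by omega)).trans_lt (lt_of_le_of_lt ?_ hm)⟩
    exact pow_le_pow_of_le_one (by norm_num) (by norm_num) (le_max_right _ _)
  choose l hl using hcau
  have hφl : ∀ i, Tendsto (fun n => φ (z n i)) atTop (𝓝 (φ (l i))) := fun i =>
    (hφ.tendsto _).comp (hl i)
  have hfst : ∀ i, (φ (l i)).1 = (φ (l 0)).1 := by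
    intro i
    refine tendsto_nhds_unique ((continuous_fst.tendsto _).comp (hφl i)) ?_
    refine ((continuous_fst.tendsto _).comp (hφl 0)).congr fun n => ?_
    exact ((B n).2.same _ (hz n) i).symm
  have hldist : ∀ n, dist (l (n.unpair).1) (l (n + 1)) ≤ (1 / 2 : ℝ) ^ n := by
    intro n
    refine le_of_tendsto ((hl _).dist (hl _)) ?_
    filter_upwards [eventually_gt_atTop n] with m hm
    exact hnear n (B n) _ (hanti (Nat.succ_le_of_lt hm) (hz m))
  have hlne : ∀ n, φ (l (n.unpair).1) ≠ φ (l (n + 1)) := by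
    intro n
    obtain ⟨δ, hδ, h⟩ := hsepar n (B n)
    have : δ ≤ dist (φ (l (n.unpair).1)) (φ (l (n + 1))) := by
      refine ge_of_tendsto ((hφl _).dist (hφl _)) ?_
      filter_upwards [eventually_gt_atTop n] with m hm
      exact h _ (hanti (Nat.succ_le_of_lt hm) (hz m))
    exact dist_pos.1 (hδ.trans_le this)
  set K : Set P := closure (range l) with hK
  have hKl : ∀ i, l i ∈ K := fun i => subset_closure (mem_range_self i)
  have hKc : IsClosed K := isClosed_closure
  have : CompleteSpace K := hKc.completeSpace_coe
  have : Nonempty K := ⟨⟨l 0, hKl 0⟩⟩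
  set x := (φ (l 0)).1
  have hKx : ∀ p : K, (φ p).1 = x := by
    intro p
    have hcl : IsClosed {p : P | (φ p).1 = x} := isClosed_eq hφ.fst continuous_const
    exact closure_minimal (by rintro _ ⟨i, rfl⟩; exact hfst i) hcl p.2
  have : Countable {y | (x, y) ∈ range φ} := (hcount x).to_subtype
  obtain ⟨y, hy⟩ := nonempty_interior_of_iUnion_of_closed
    (f := fun y : {y | (x, y) ∈ range φ} => {p : K | (φ p).2 = y})
    (fun y => isClosed_eq (hφ.snd.comp continuous_subtype_val) continuous_const)
    (by
      refine eq_univ_of_forall fun p => mem_iUnion.2 ⟨⟨(φ p).2, ?_⟩, rfl⟩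
      exact ⟨p, Prod.ext (hKx p) rfl⟩)
  have hdense : DenseRange fun i => (⟨l i, hKl i⟩ : K) := by
    intro p
    rw [closure_subtype]
    have : ((↑) '' range fun i => (⟨l i, hKl i⟩ : K)) = range l := by
      rw [← range_comp]; rfl
    rw [this]; exact p.2
  obtain ⟨i, hi⟩ := hdense.exists_mem_open isOpen_interior hy
  obtain ⟨ε, hε, hball⟩ := Metric.isOpen_iff.1 isOpen_interior _ hi
  obtain ⟨m, hm⟩ := exists_pow_lt_of_lt_one hε (by norm_num : (1 / 2 : ℝ) < 1)
  have hn : m ≤ Nat.pair i m := Nat.right_le_pair i m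
  have h1 := hldist (Nat.pair i m)
  have h2 := hlne (Nat.pair i m)
  rw [Nat.unpair_pair] at h1 h2
  have h3 : (⟨l (Nat.pair i m + 1), hKl _⟩ : K) ∈ Metric.ball (⟨l i, hKl i⟩ : K) ε := by
    rw [Metric.mem_ball, Subtype.dist_eq, dist_comm]
    exact (h1.trans (pow_le_pow_of_le_one (by norm_num) (by norm_num) hn)).trans_lt hm
  have hval : ∀ {q : K}, q ∈ interior {p : K | (φ p).2 = y} → (φ q).2 = y := fun {q} hq =>
    (interior_subset hq : q ∈ {p : K | (φ p).2 = y})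
  have h4 : (φ (l i)).2 = y := hval hi
  have h5 : (φ (l (Nat.pair i m + 1))).2 = y := hval (hball h3)
  exact h2 (Prod.ext ((hfst i).trans (hfst _).symm) (h4.trans h5.symm))

end LusinNovikov

/-- A consequence of Lusin-Novikov uniformization: a countable Borel equivalence relation is
covered by the graphs of countably many Borel functions. -/
theorem exists_measurable_enumeration {X : Type*} [MeasurableSpace X] [StandardBorelSpace X]
    {E : X → X → Prop} (hE : Equivalence E) (hm : MeasurableSet {p : X × X | E p.1 p.2})
    (hc : ∀ x, {y | E x y}.Countable) :
    ∃ f : ℕ → X → X, (∀ i, Measurable (f i)) ∧ ∀ x y, E x y ↔ ∃ i, f i x = y := by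
  let _ := upgradeStandardBorel X
  let _ := TopologicalSpace.upgradeIsCompletelyMetrizable X
  let _ := TopologicalSpace.upgradeIsCompletelyMetrizable (ℕ → ℕ)
  obtain ⟨𝒢, h𝒢, hG, hcov⟩ : ∃ 𝒢 : Set (Set (X × X)), 𝒢.Countable ∧
      (∀ G ∈ 𝒢, IsBorelGraph G) ∧ ∀ p : X × X, E p.1 p.2 → ∃ G ∈ 𝒢, p ∈ G := by
    have ha := hm.analyticSet
    rw [MeasureTheory.AnalyticSet] at ha
    rcases ha with h | ⟨φ, hφ, hr⟩
    · refine ⟨∅, Set.countable_empty, by simp, fun p hp => ?_⟩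
      exact absurd (show p ∈ {p : X × X | E p.1 p.2} from hp) (by simp [h])
    · obtain ⟨𝒢, h1, h2, h3⟩ := exists_countable_isBorelGraph_cover hφ (by
        intro x; rw [hr]; exact hc x)
      refine ⟨𝒢, h1, h2, fun p hp => ?_⟩
      have : p ∈ Set.range φ := by rw [hr]; exact hp
      obtain ⟨q, rfl⟩ := this
      exact h3 q
  obtain ⟨g, hg⟩ : ∃ g : ℕ → Set (X × X), insert ∅ 𝒢 = Set.range g :=
    (h𝒢.insert ∅).exists_eq_range (Set.insert_nonempty _ _)
  have hgG : ∀ n, IsBorelGraph (g n) := by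
    intro n
    have : g n ∈ insert ∅ 𝒢 := by rw [hg]; exact ⟨n, rfl⟩
    rcases this with h | h
    · rw [h]; exact ⟨MeasurableSet.empty, by simp⟩
    · exact hG _ h
  let H : ℕ → Set (X × X) := fun n => g n ∩ {p | E p.1 p.2}
  have hHm : ∀ n, MeasurableSet (H n) := fun n => (hgG n).1.inter hm
  have hHinj : ∀ n, Set.InjOn Prod.fst (H n) := fun n p hp q hq h => (hgG n).2 p hp.1 q hq.1 h
  have hf : ∀ n, ∃ f : X → X, Measurable f ∧ (∀ x, E x (f x)) ∧ ∀ p ∈ H n, f p.1 = p.2 := by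
    intro n
    let D : Set X := Prod.fst '' H n
    have hch : ∀ x : X, ∃ y, E x y ∧ ∀ p ∈ H n, p.1 = x → p.2 = y := by
      intro x
      by_cases hx : x ∈ D
      · obtain ⟨p, hp, rfl⟩ := hx
        exact ⟨p.2, hp.2, fun q hq h => by rw [hHinj n hq hp h]⟩
      · exact ⟨x, hE.refl x, fun p hp h => absurd ⟨p, hp, h⟩ hx⟩
    let f : X → X := fun x => if h : ∃ y, (x, y) ∈ H n then h.choose else x
    have hfp : ∀ p ∈ H n, f p.1 = p.2 := by
      intro p hp
      have h : ∃ y, (p.1, y) ∈ H n := ⟨p.2, hp⟩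
      simp only [f, dif_pos h]
      have := hHinj n h.choose_spec hp rfl
      exact congrArg Prod.snd this
    have hfn : ∀ x, x ∉ D → f x = x := by
      intro x hx
      have h : ¬ ∃ y, (x, y) ∈ H n := fun ⟨y, hy⟩ => hx ⟨_, hy, rfl⟩
      simp only [f, dif_neg h]
    refine ⟨f, ?_, ?_, hfp⟩
    · intro s hs
      have hD : MeasurableSet D := (hHm n).image_of_measurable_injOn measurable_fst (hHinj n)
      have hDs : MeasurableSet (Prod.fst '' (H n ∩ Prod.snd ⁻¹' s)) :=
        ((hHm n).inter (measurable_snd hs)).image_of_measurable_injOn measurable_fst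
          ((hHinj n).mono Set.inter_subset_left)
      have e : f ⁻¹' s = Prod.fst '' (H n ∩ Prod.snd ⁻¹' s) ∪ (Dᶜ ∩ s) := by
        ext x
        by_cases hx : x ∈ D
        · obtain ⟨p, hp, rfl⟩ := hx
          have hpD : p.1 ∈ D := ⟨p, hp, rfl⟩
          simp only [Set.mem_preimage, hfp p hp, Set.mem_union, Set.mem_image, Set.mem_inter_iff,
            Set.mem_compl_iff, hpD, not_true_eq_false, false_and, or_false]
          exact ⟨fun h => ⟨p, ⟨hp, h⟩, rfl⟩, fun ⟨q, ⟨hq, hqs⟩, h⟩ => by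
            rw [← hHinj n hq hp h]; exact hqs⟩
        · simp only [Set.mem_preimage, hfn x hx, Set.mem_union, Set.mem_inter_iff,
            Set.mem_compl_iff, hx, not_false_eq_true, true_and]
          exact ⟨Or.inr, fun h => h.resolve_left fun ⟨q, hq, h⟩ => hx ⟨q, hq.1, h⟩⟩
      rw [e]
      exact hDs.union (hD.compl.inter hs)
    · intro x
      by_cases hx : x ∈ D
      · obtain ⟨p, hp, rfl⟩ := hx
        rw [hfp p hp]; exact hp.2
      · rw [hfn x hx]; exact hE.refl x
  choose f hf1 hf2 hf3 using hf
  refine ⟨fun i => Nat.casesOn i id f, fun i => ?_, fun x y => ⟨fun h => ?_, ?_⟩⟩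
  · cases i with
    | zero => exact measurable_id
    | succ i => exact hf1 i
  · obtain ⟨G, hG1, hG2⟩ := hcov (x, y) h
    have : G ∈ Set.range g := by rw [← hg]; exact Set.mem_insert_of_mem _ hG1
    obtain ⟨n, rfl⟩ := this
    exact ⟨n + 1, hf3 n (x, y) ⟨hG2, h⟩⟩
  · rintro ⟨i, rfl⟩
    cases i with
    | zero => exact hE.refl x
    | succ i => exact hf2 i x

section GenericSets

/-- `m` codes (by its binary digits below the leading one) an initial segment of `z`. -/
def Pref (m : ℕ) (z : ℕ → Bool) : Prop := ∀ k, 2 ^ (k + 1) ≤ m → m.testBit k = z k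

/-- The strings coded by `m` and `m'` are incompatible. -/
def Incompat (m m' : ℕ) : Prop :=
  ∃ k, 2 ^ (k + 1) ≤ m ∧ 2 ^ (k + 1) ≤ m' ∧ m.testBit k ≠ m'.testBit k

theorem exists_pref (z : ℕ → Bool) (l : ℕ) : ∃ m, l ≤ m ∧ Pref m z := by
  refine ⟨2 ^ l + Nat.ofBits (fun i : Fin l => z i), ?_, fun k hk => ?_⟩
  · have := (Nat.lt_two_pow_self (n := l)).le
    omega
  · have h1 : Nat.ofBits (fun i : Fin l => z i) < 2 ^ l := Nat.ofBits_lt_two_pow _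
    have h2 : 2 ^ (k + 1) < 2 ^ (l + 1) := by rw [pow_succ 2 l]; omega
    have h3 : k < l := by
      have := (Nat.pow_lt_pow_iff_right (by norm_num : 1 < 2)).1 h2
      omega
    rw [Nat.testBit_two_pow_add_gt h3, Nat.testBit_ofBits_lt _ _ h3]

theorem Pref.not_incompat {m m' : ℕ} {z : ℕ → Bool} (h : Pref m z) (h' : Pref m' z) :
    ¬ Incompat m m' := by
  rintro ⟨k, h1, h2, h3⟩
  exact h3 ((h k h1).trans (h' k h2).symm)

variable {X : Type*} [MeasurableSpace X]

theorem measurable_subst {ℓ : X → ℕ} (hℓ : Measurable ℓ) {R : ℕ → X → Prop}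
    (hR : ∀ n, Measurable (R n)) : Measurable fun x => R (ℓ x) x := by
  have e : (fun x => R (ℓ x) x) = fun x => ∃ n, ℓ x = n ∧ R n x := by
    ext x; simp
  rw [e]
  refine Measurable.exists fun n => Measurable.and ?_ (hR n)
  exact measurableSet_setOfPred.1 (hℓ (measurableSet_singleton n))

theorem exists_measurable_choice {p : ℕ → X → Prop} (hp : ∀ n, Measurable (p n)) :
    ∃ N : X → ℕ, Measurable N ∧ ∀ x, (∃ n, p n x) → p (N x) x := by
  have hex : ∀ x, ∃ n, (∃ m, p m x) → p n x := fun x => by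
    by_cases h : ∃ m, p m x
    · exact ⟨h.choose, fun _ => h.choose_spec⟩
    · exact ⟨0, fun h' => absurd h' h⟩
  refine ⟨fun x => Nat.find (hex x), measurable_find hex fun k => ?_, fun x => Nat.find_spec (hex x)⟩
  exact measurableSet_setOfPred.2 ((Measurable.exists hp).imp (hp k))

theorem measurable_count {S : X → Set ℕ} (hS : ∀ n, Measurable fun x => n ∈ S x) (N : ℕ) :
    Measurable fun x => Nat.count (· ∈ S x) N := by
  induction N with
  | zero => simp
  | succ N ih =>
    simp only [Nat.count_succ]
    exact ih.add (Measurable.ite (measurableSet_setOfPred.2 (hS N)) measurable_const measurable_const)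

theorem measurable_infinite {S : X → Set ℕ} (hS : ∀ n, Measurable fun x => n ∈ S x) :
    Measurable fun x => (S x).Infinite := by
  simp only [Set.infinite_iff_exists_gt]
  exact Measurable.forall fun N => Measurable.exists fun n => (hS n).and measurable_const

theorem exists_le_count {S : Set ℕ} (hS : S.Infinite) (k : ℕ) : ∃ L, k ≤ Nat.count (· ∈ S) L :=
  ⟨Nat.nth (fun n => n ∈ S) k, (Nat.count_nth_of_infinite (p := fun n => n ∈ S) hS k).ge⟩

theorem count_le_add_two {A B : Set ℕ} {u v : ℕ} (h : ∀ n ∈ B, n ∈ A ∨ n = u ∨ n = v) (N : ℕ) :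
    Nat.count (· ∈ B) N ≤ Nat.count (· ∈ A) N + 2 := by
  simp only [Nat.count_eq_card_filter_range]
  have : (Finset.range N).filter (· ∈ B) ⊆ (Finset.range N).filter (· ∈ A) ∪ {u, v} := by
    intro n hn
    simp only [Finset.mem_filter, Finset.mem_union, Finset.mem_insert, Finset.mem_singleton] at hn ⊢
    rcases h n hn.2 with h | h
    · exact Or.inl ⟨hn.1, h⟩
    · exact Or.inr h
  exact (Finset.card_le_card this).trans ((Finset.card_union_le _ _).trans
    (Nat.add_le_add_left Finset.card_le_two _))

/-- A stage of the construction of a Borel family of sparse sets: the sets are decided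
below `len`. -/
structure Stage (hat : X → ℕ → Bool) where
  /-- the elements put in so far -/
  set : X → Set ℕ
  /-- the bound below which the sets have been decided -/
  len : X → ℕ
  meas_set : ∀ n, Measurable fun x => n ∈ set x
  meas_len : Measurable len
  lt_len : ∀ x, ∀ n ∈ set x, n < len x
  pref : ∀ x, ∀ n ∈ set x, Pref n (hat x)

variable {hat : X → ℕ → Bool}

/-- `s'` extends `s` and adds at most two elements to each set. -/
structure Stage.Ext (s s' : Stage hat) : Prop where
  le : ∀ x, s.len x ≤ s'.len x
  agree : ∀ x, ∀ n < s.len x, n ∈ s'.set x ↔ n ∈ s.set x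
  count_le : ∀ x N, Nat.count (· ∈ s'.set x) N ≤ Nat.count (· ∈ s.set x) N + 2

/-- A family of sets agrees with a stage. -/
def Stage.Agrees (s : Stage hat) (Z : X → Set ℕ) : Prop :=
  ∀ x, ∀ n < s.len x, n ∈ Z x ↔ n ∈ s.set x

/-- A requirement that can be forced by extending any given stage. -/
def Forceable (hat : X → ℕ → Bool) (R : (X → Set ℕ) → Prop) : Prop :=
  ∀ s : Stage hat, ∃ s', s.Ext s' ∧ ∀ Z, s'.Agrees Z → R Z

theorem Stage.exists_pad (s : Stage hat) {S : ℕ → X → Set ℕ}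
    (hS : ∀ j n, Measurable fun x => n ∈ S j x) (t : ℕ) :
    ∃ ℓ : X → ℕ, Measurable ℓ ∧ (∀ x, s.len x < ℓ x) ∧ ∀ x, ∀ j ≤ t, (S j x).Infinite →
      Nat.count (· ∈ S j x) (s.len x) + 4 ≤ Nat.count (· ∈ S j x) (ℓ x) := by
  obtain ⟨ℓ, hℓ, h⟩ := exists_measurable_choice (p := fun L x => s.len x < L ∧ ∀ j, j ≤ t →
      (S j x).Infinite → Nat.count (· ∈ S j x) (s.len x) + 4 ≤ Nat.count (· ∈ S j x) L) (by
    intro L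
    refine Measurable.and (measurableSet_setOfPred.1 (measurableSet_lt s.meas_len measurable_const))
      (Measurable.forall fun j => measurable_const.imp ((measurable_infinite (hS j)).imp ?_))
    refine measurable_subst s.meas_len
      (R := fun n x => Nat.count (· ∈ S j x) n + 4 ≤ Nat.count (· ∈ S j x) L) fun n => ?_
    exact measurableSet_setOfPred.1 (measurableSet_le ((measurable_count (hS j) n).add_const 4)
      (measurable_count (hS j) L)))
  have hex : ∀ x, ∃ L, s.len x < L ∧ ∀ j, j ≤ t → (S j x).Infinite →
      Nat.count (· ∈ S j x) (s.len x) + 4 ≤ Nat.count (· ∈ S j x) L := by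
    intro x
    have : ∀ j, ∃ L, (S j x).Infinite →
        Nat.count (· ∈ S j x) (s.len x) + 4 ≤ Nat.count (· ∈ S j x) L := by
      intro j
      by_cases hj : (S j x).Infinite
      · obtain ⟨L, hL⟩ := exists_le_count hj (Nat.count (· ∈ S j x) (s.len x) + 4)
        exact ⟨L, fun _ => hL⟩
      · exact ⟨0, fun h => absurd h hj⟩
    choose L hL using this
    refine ⟨max (s.len x + 1) ((Finset.range (t + 1)).sup L), by omega, fun j hj hi => ?_⟩
    refine (hL j hi).trans (Nat.count_monotone _ ?_)
    exact le_max_of_le_right (Finset.le_sup (f := L) (Finset.mem_range.2 (by omega)))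
  exact ⟨ℓ, hℓ, fun x => (h x (hex x)).1, fun x => (h x (hex x)).2⟩

theorem exists_sparse_generic {S : ℕ → X → Set ℕ} (hS : ∀ j n, Measurable fun x => n ∈ S j x)
    {R : ℕ → (X → Set ℕ) → Prop} (hR : ∀ i, Forceable hat (R i)) :
    ∃ Z : X → Set ℕ, (∀ n, Measurable fun x => n ∈ Z x) ∧ (∀ x, ∀ n ∈ Z x, Pref n (hat x)) ∧
      (∀ j x, (S j x).Infinite →
        ∃ C, ∀ N, 2 * Nat.count (· ∈ Z x) N ≤ Nat.count (· ∈ S j x) N + C) ∧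
      ∀ i, R i Z := by
  have step : ∀ (t : ℕ) (s : Stage hat), ∃ s', s.Ext s' ∧ (∀ Z, s'.Agrees Z → R t Z) ∧
      (∀ x, s.len x < s'.len x) ∧ ∀ x, ∀ j ≤ t, (S j x).Infinite →
      Nat.count (· ∈ S j x) (s.len x) + 4 ≤ Nat.count (· ∈ S j x) (s'.len x) := by
    intro t s
    obtain ⟨s₁, h1, h2⟩ := hR t s
    obtain ⟨ℓ, hℓ, h3, h4⟩ := s₁.exists_pad hS t
    refine ⟨⟨s₁.set, ℓ, s₁.meas_set, hℓ, fun x n hn => (s₁.lt_len x n hn).trans (h3 x), s₁.pref⟩,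
      ⟨fun x => (h1.le x).trans (h3 x).le, h1.agree, h1.count_le⟩, fun Z hZ => h2 Z fun x n hn =>
      hZ x n (hn.trans (h3 x)), fun x => (h1.le x).trans_lt (h3 x), fun x j hj hi => ?_⟩
    refine le_trans ?_ (h4 x j hj hi)
    exact Nat.add_le_add_right (Nat.count_monotone _ (h1.le x)) 4
  choose next hext hforce hlt hcount using step
  let s₀ : Stage hat := ⟨fun _ => ∅, fun _ => 0, fun n => by simp, measurable_const,
    by simp, by simp⟩
  let s : ℕ → Stage hat := fun t => Nat.rec s₀ next t
  have hlen : ∀ x, Monotone fun t => (s t).len x := fun x =>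
    monotone_nat_of_le_succ fun t => (hlt t (s t) x).le
  have hlenge : ∀ x t, t ≤ (s t).len x := by
    intro x t
    induction t with
    | zero => exact Nat.zero_le _
    | succ t ih => exact ih.trans_lt (hlt t (s t) x)
  have hagree : ∀ x t u, t ≤ u → ∀ n < (s t).len x, n ∈ (s u).set x ↔ n ∈ (s t).set x := by
    intro x t u htu
    induction u, htu using Nat.le_induction with
    | base => intro n _; rfl
    | succ u hu ih =>
      intro n hn
      exact ((hext u (s u)).agree x n (hn.trans_le (hlen x hu))).trans (ih n hn)
  have hcnt : ∀ x t N, Nat.count (· ∈ (s t).set x) N ≤ 2 * t := by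
    intro x t N
    induction t with
    | zero =>
      have : Nat.count (· ∈ (s 0).set x) N = 0 := by
        simp [Nat.count_eq_card_filter_range, s, s₀]
      omega
    | succ t ih =>
      have := (hext t (s t)).count_le x N
      change Nat.count (· ∈ (s (t + 1)).set x) N ≤ _ at this
      omega
  let Z : X → Set ℕ := fun x => {n | ∃ t, n ∈ (s t).set x}
  have hZ : ∀ t, (s t).Agrees Z := by
    intro t x n hn
    refine ⟨fun ⟨u, hu⟩ => ?_, fun h => ⟨t, h⟩⟩
    rcases le_total t u with h | h
    · exact (hagree x t u h n hn).1 hu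
    · exact (hagree x u t h n ((s u).lt_len x n hu)).2 hu
  refine ⟨Z, fun n => Measurable.exists fun t => (s t).meas_set n, fun x n ⟨t, ht⟩ =>
    (s t).pref x n ht, fun j x hi => ⟨4 * j + 4, ?_⟩, fun i => hforce i (s i) Z (hZ (i + 1))⟩
  have hSj : ∀ t, 4 * t ≤ Nat.count (· ∈ S j x) ((s t).len x) + 4 * j := by
    intro t
    induction t with
    | zero => omega
    | succ t ih =>
      by_cases hjt : j ≤ t
      · have := hcount t (s t) x j hjt hi
        change _ ≤ Nat.count (· ∈ S j x) ((s (t + 1)).len x) at this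
        omega
      · omega
  have hZc : ∀ t N, N ≤ (s t).len x → Nat.count (· ∈ Z x) N ≤ 2 * t := by
    intro t N hN
    refine le_trans (le_of_eq ?_) (hcnt x t N)
    simp only [Nat.count_eq_card_filter_range]
    congr 1
    refine Finset.filter_congr fun n hn => hZ t x n ?_
    have := Finset.mem_range.1 hn
    omega
  have main : ∀ t N, N ≤ (s t).len x →
      2 * Nat.count (· ∈ Z x) N ≤ Nat.count (· ∈ S j x) N + (4 * j + 4) := by
    intro t
    induction t with
    | zero =>
      intro N hN
      have := hZc 0 N hN
      omega
    | succ t ih =>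
      intro N hN
      by_cases h : N ≤ (s t).len x
      · exact ih N h
      · have h1 := hZc (t + 1) N hN
        have h2 := hSj t
        have h3 : Nat.count (· ∈ S j x) ((s t).len x) ≤ Nat.count (· ∈ S j x) N :=
          Nat.count_monotone _ (by omega)
        omega
  exact fun N => main N N (hlenge x N)

theorem measurable_pref {z : X → ℕ → Bool} (hz : Measurable z) (m : ℕ) :
    Measurable fun x => Pref m (z x) := by
  refine Measurable.forall fun k => measurable_const.imp (measurableSet_setOfPred.1 ?_)
  exact measurableSet_eq_fun measurable_const ((measurable_pi_apply k).comp hz)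

theorem forceable_unbounded (hhat : Measurable hat) (l : ℕ) :
    Forceable hat fun Z => ∀ x, ∃ n ∈ Z x, l ≤ n := by
  intro s
  obtain ⟨N, hN, h⟩ := exists_measurable_choice
    (p := fun n x => max l (s.len x) ≤ n ∧ Pref n (hat x)) fun n =>
      (measurableSet_setOfPred.1 (measurableSet_le (measurable_const.max s.meas_len)
        measurable_const)).and (measurable_pref hhat n)
  replace h := fun x => h x (exists_pref _ _)
  refine ⟨⟨fun x => {n | n ∈ s.set x ∨ n = N x}, fun x => N x + 1, fun n => ?_, hN.add_const 1,
    ?_, ?_⟩, ⟨?_, ?_, ?_⟩, ?_⟩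
  · exact (s.meas_set n).or (measurableSet_setOfPred.1 (measurableSet_eq_fun measurable_const hN))
  · rintro x n (hn | rfl)
    · have := s.lt_len x n hn
      have := (h x).1
      omega
    · omega
  · rintro x n (hn | rfl)
    · exact s.pref x n hn
    · exact (h x).2
  · intro x
    have := (h x).1
    simp only
    omega
  · intro x n hn
    have := (h x).1
    refine ⟨fun h' => h'.resolve_right (by omega), Or.inl⟩
  · intro x
    exact count_le_add_two (u := N x) (v := N x) fun n hn => hn.imp_right Or.inl
  · intro Z hZ x
    have := (h x).1
    exact ⟨N x, (hZ x (N x) (Nat.lt_succ_self _)).2 (Or.inr rfl), by omega⟩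

theorem forceable_incompat (hhat : Measurable hat) {Q : X → Set ℕ}
    (hQ : ∀ n, Measurable fun x => n ∈ Q x) (a : ℕ → ℕ) :
    Forceable hat fun Z => ∀ x,
      (∀ l, ∃ m ∈ Q x, ∃ m' ∈ Q x, l ≤ a m ∧ l ≤ a m' ∧ Pref (a m) (hat x) ∧
        Pref (a m') (hat x) ∧ Incompat m m') →
      ∃ m ∈ Q x, ∃ m' ∈ Q x, Incompat m m' ∧ a m ∈ Z x ∧ a m' ∈ Z x := by
  intro s
  let p : ℕ → X → Prop := fun n x => n.unpair.1 ∈ Q x ∧ n.unpair.2 ∈ Q x ∧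
    s.len x ≤ a n.unpair.1 ∧ s.len x ≤ a n.unpair.2 ∧ Pref (a n.unpair.1) (hat x) ∧
    Pref (a n.unpair.2) (hat x) ∧ Incompat n.unpair.1 n.unpair.2
  have hp : ∀ n, Measurable (p n) := fun n =>
    (hQ _).and ((hQ _).and ((measurableSet_setOfPred.1 (measurableSet_le s.meas_len
      measurable_const)).and ((measurableSet_setOfPred.1 (measurableSet_le s.meas_len
      measurable_const)).and ((measurable_pref hhat _).and ((measurable_pref hhat _).and
      measurable_const)))))
  obtain ⟨N, hN, h⟩ := exists_measurable_choice hp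
  let m : X → ℕ := fun x => a (N x).unpair.1
  let m' : X → ℕ := fun x => a (N x).unpair.2
  have hm : Measurable m := (measurable_from_nat (f := fun n => a n.unpair.1)).comp hN
  have hm' : Measurable m' := (measurable_from_nat (f := fun n => a n.unpair.2)).comp hN
  refine ⟨⟨fun x => {n | n ∈ s.set x ∨ p (N x) x ∧ (n = m x ∨ n = m' x)},
    fun x => max (s.len x) (max (m x + 1) (m' x + 1)), fun n => ?_,
    s.meas_len.max ((hm.add_const 1).max (hm'.add_const 1)), ?_, ?_⟩, ⟨?_, ?_, ?_⟩, ?_⟩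
  · exact (s.meas_set n).or ((measurable_subst hN hp).and
      ((measurableSet_setOfPred.1 (measurableSet_eq_fun measurable_const hm)).or
        (measurableSet_setOfPred.1 (measurableSet_eq_fun measurable_const hm'))))
  · rintro x n (hn | ⟨-, rfl | rfl⟩)
    · have := s.lt_len x n hn
      omega
    · omega
    · omega
  · rintro x n (hn | ⟨hn, rfl | rfl⟩)
    · exact s.pref x n hn
    · exact hn.2.2.2.2.1
    · exact hn.2.2.2.2.2.1
  · intro x
    exact le_max_left _ _
  · intro x n hn
    refine ⟨fun h' => h'.resolve_right ?_, Or.inl⟩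
    rintro ⟨h1, rfl | rfl⟩
    · exact absurd h1.2.2.1 (by simpa using hn)
    · exact absurd h1.2.2.2.1 (by simpa using hn)
  · intro x
    exact count_le_add_two (u := m x) (v := m' x) fun n hn => hn.imp_right And.right
  · intro Z hZ x hx
    obtain ⟨k, hk, k', hk', h1, h2, h3, h4, h5⟩ := hx (s.len x)
    have hpN : p (N x) x := h x ⟨Nat.pair k k', by simp [p, *]⟩
    refine ⟨_, hpN.1, _, hpN.2.1, hpN.2.2.2.2.2.2, (hZ x _ ?_).2 (Or.inr ⟨hpN, Or.inl rfl⟩),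
      (hZ x _ ?_).2 (Or.inr ⟨hpN, Or.inr rfl⟩)⟩
    · simp only [m]; omega
    · simp only [m']; omega

theorem forceable_diagonal (hhat : Measurable hat) (hinj : Function.Injective hat) {Q : X → Set ℕ}
    (hQ : ∀ n, Measurable fun x => n ∈ Q x) (a : ℕ → ℕ) {α β : X → X} (hα : Measurable α)
    (hβ : Measurable β) (k : ℕ) (b : Bool) :
    Forceable hat fun Z => ∀ x, hat x k = b → hat (α x) k ≠ b → β (α x) = x →
      (∀ l, ∃ m ∈ Q (α x), l ≤ m ∧ Pref m (hat x)) →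
      ∃ m ∈ Q (α x), ¬ (m ∈ Z x ↔ a m ∈ Z (α x)) := by
  intro s
  let p : ℕ → X → Prop := fun n x => s.len x ≤ n ∧ n ∈ Q (α x) ∧ Pref n (hat x)
  have hp : ∀ n, Measurable (p n) := fun n =>
    (measurableSet_setOfPred.1 (measurableSet_le s.meas_len measurable_const)).and
      (((hQ n).comp hα).and (measurable_pref hhat n))
  obtain ⟨N, hN, h⟩ := exists_measurable_choice hp
  let role : X → Prop := fun x => hat x k = b ∧ hat (α x) k ≠ b ∧ β (α x) = x
  have hrole : Measurable role := by
    have hk : Measurable fun x => hat x k = b :=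
      measurableSet_setOfPred.1 (measurableSet_eq_fun ((measurable_pi_apply k).comp hhat)
        measurable_const)
    refine hk.and ((hk.comp hα).not.and ?_)
    have e : (fun x => β (α x) = x) = fun x => ∀ n, hat (β (α x)) n = hat x n := by
      ext x
      rw [← hinj.eq_iff, funext_iff]
    rw [e]
    exact Measurable.forall fun n => measurableSet_setOfPred.1 (measurableSet_eq_fun
      ((measurable_pi_apply n).comp (hhat.comp (hβ.comp hα))) ((measurable_pi_apply n).comp hhat))
  refine ⟨⟨fun x => {n | n ∈ s.set x ∨ role x ∧ p (N x) x ∧ n = N x ∧ a (N x) ∉ s.set (α x)},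
    fun x => max (s.len x) (max (N x + 1) (a (N (β x)) + 1)), fun n => ?_, ?_, ?_, ?_⟩,
    ⟨?_, ?_, ?_⟩, ?_⟩
  · exact (s.meas_set n).or (hrole.and ((measurable_subst hN hp).and
      ((measurableSet_setOfPred.1 (measurableSet_eq_fun measurable_const hN)).and
      (measurable_subst hN (R := fun i x => a i ∉ s.set (α x))
        fun i => ((s.meas_set (a i)).comp hα).not))))
  · exact s.meas_len.max ((hN.add_const 1).max
      (((measurable_from_nat (f := fun n => a n + 1)).comp hN).comp hβ))
  · rintro x n (hn | ⟨-, -, rfl, -⟩)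
    · have := s.lt_len x n hn
      omega
    · omega
  · rintro x n (hn | ⟨-, hn, rfl, -⟩)
    · exact s.pref x n hn
    · exact hn.2.2
  · intro x
    exact le_max_left _ _
  · intro x n hn
    refine ⟨fun h' => h'.resolve_right ?_, Or.inl⟩
    rintro ⟨-, h1, rfl, -⟩
    exact absurd h1.1 (by simpa using hn)
  · intro x
    exact count_le_add_two (u := N x) (v := N x) fun n hn => hn.imp_right fun h => Or.inl h.2.2.1
  · intro Z hZ x h1 h2 h3 h4
    obtain ⟨m, hm1, hm2, hm3⟩ := h4 (s.len x)
    have hpN : p (N x) x := h x ⟨m, hm2, hm1, hm3⟩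
    refine ⟨N x, hpN.2.1, ?_⟩
    have e1 := hZ x (N x) (by simp)
    have e2 := hZ (α x) (a (N x)) (by simp [h3])
    have hr : role x := ⟨h1, h2, h3⟩
    have hr' : ¬ role (α x) := fun h' => h2 h'.1
    have hn : N x ∉ s.set x := fun h' => absurd (s.lt_len x _ h') (not_lt.2 hpN.1)
    rw [e1, e2]
    simp only [Set.mem_ofPred_eq, hr, hr', hn, hpN, true_and, false_and, or_false, false_or]
    tauto

end GenericSets

section Effective

theorem RecursiveIn.of_partrec {O : ℕ → ℕ} {f : ℕ →. ℕ} (hf : Nat.Partrec f) :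
    RecursiveIn O f := by
  induction hf with
  | zero => exact .zero
  | succ => exact .succ
  | left => exact .left
  | right => exact .right
  | pair _ _ h1 h2 => exact .pair h1 h2
  | comp _ _ h1 h2 => exact .comp h1 h2
  | prec _ _ h1 h2 => exact .prec h1 h2
  | rfind _ h => exact .rfind h

theorem turingLE_of_computable {x z : ℕ → Bool} {σ : ℕ → ℕ} (hσ : Computable σ)
    (h : ∀ n, z n = x (σ n)) : TuringLE z x := by
  have h1 : RecursiveIn (oracleOf x) fun n => Part.some (σ n) :=
    RecursiveIn.of_partrec (Partrec.nat_iff.1 hσ)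
  have h2 := RecursiveIn.comp RecursiveIn.oracle h1
  have e : (fun n => Part.some (σ n) >>= fun n => Part.some (oracleOf x n) : ℕ →. ℕ) =
      fun n => Part.some (oracleOf z n) := by
    funext n
    simp only [Part.bind_eq_bind, Part.bind_some, oracleOf, h]
  exact (congrArg (RecursiveIn (oracleOf x)) e).mp h2

theorem countable_computable (α : Type*) [Primcodable α] :
    Countable {r : ℕ → α // Computable r} := by
  have h : ∀ r : {r : ℕ → α // Computable r}, ∃ c : Nat.Partrec.Code,
      c.eval = fun n => Part.some (Encodable.encode (r.1 n)) := fun r =>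
    Nat.Partrec.Code.exists_code.1 (Partrec.nat_iff.1 (Computable.encode.comp r.2))
  choose c hc using h
  refine Function.Injective.countable (f := c) fun r r' hr => Subtype.ext (funext fun n => ?_)
  have := congrFun ((hc r).symm.trans ((congrArg _ hr).trans (hc r'))) n
  exact Encodable.encode_injective (Part.some_injective this)

/-- There is a function escaping, for each of countably many unbounded sets of pairs,
some member of the set. -/
theorem exists_password {ι : Type*} [Countable ι] (S : ι → Set (ℕ × ℕ)) :
    ∃ c : ℕ → ℕ, ∀ e, (∀ N, ∃ p ∈ S e, N ≤ p.1) → ∃ p ∈ S e, p.2 ≠ c p.1 := by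
  rcases isEmpty_or_nonempty ι with h | h
  · exact ⟨id, fun e => h.elim e⟩
  obtain ⟨g, hg⟩ := exists_surjective_nat ι
  let v : ℕ → ℕ → ℕ := fun n e => if h : ∃ s, (n, s) ∈ S (g e) then h.choose else 0
  refine ⟨fun n => (Finset.range (n + 1)).sup (v n) + 1, fun e he => ?_⟩
  obtain ⟨k, rfl⟩ := hg e
  obtain ⟨⟨n, s⟩, hp, hk⟩ := he k
  have h : ∃ s, (n, s) ∈ S (g k) := ⟨s, hp⟩
  refine ⟨(n, h.choose), h.choose_spec, ?_⟩
  have h1 : v n k ≤ (Finset.range (n + 1)).sup (v n) :=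
    Finset.le_sup (f := v n) (Finset.mem_range.2 (Nat.lt_succ_of_le hk))
  have h2 : v n k = h.choose := dif_pos h
  simp only
  omega

/-- Paths: finite sequences of steps `(n, u, s)`, where `n` is a level, `u` a word and `s` a
password. -/
abbrev Path := List (ℕ × List ℕ × ℕ)

/-- The word composed of all the words in a path. -/
def Path.word (p : Path) : List ℕ := p.foldr (fun e w => w ++ e.2.1) []

theorem Path.primrec_word : Primrec Path.word :=
  Primrec.list_foldr (f := fun p : Path => p) (g := fun _ => ([] : List ℕ))
    (h := fun _ (q : (ℕ × List ℕ × ℕ) × List ℕ) => q.2 ++ q.1.2.1)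
    Primrec.id (Primrec.const [])
    (Primrec.list_append.comp (Primrec.snd.comp Primrec.snd)
      (Primrec.fst.comp (Primrec.snd.comp (Primrec.fst.comp Primrec.snd)))).to₂

/-- Add a step `(n, [i], s)` in front of a path. -/
def Path.cons (n i s : ℕ) (q : (Path × ℕ) × ℕ) : (Path × ℕ) × ℕ :=
  (((n, [i], s) :: q.1.1, q.1.2), 2 * q.2 + 1)

/-- Prolong the first step of a path by `i` if its level is at least `n`, or else add a step
in front of the path. -/
def Path.prolong (n i s : ℕ) (q : (Path × ℕ) × ℕ) : (Path × ℕ) × ℕ :=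
  List.casesOn q.1.1 (Path.cons n i s q) fun e p =>
    if n ≤ e.1 then (((e.1, e.2.1 ++ [i], e.2.2) :: p, q.1.2), 2 * q.2) else Path.cons n i s q

theorem Path.primrec_cons (n i s : ℕ) : Primrec (Path.cons n i s) :=
  ((Primrec.list_cons.comp (Primrec.const (n, [i], s)) (Primrec.fst.comp Primrec.fst)).pair
    (Primrec.snd.comp Primrec.fst)).pair
    (Primrec.succ.comp (Primrec.nat_double.comp Primrec.snd))

theorem Path.primrec_prolong (n i s : ℕ) : Primrec (Path.prolong n i s) := by
  refine Primrec.list_casesOn (f := fun q : (Path × ℕ) × ℕ => q.1.1) (g := Path.cons n i s)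
    (h := fun q e => if n ≤ e.1.1 then (((e.1.1, e.1.2.1 ++ [i], e.1.2.2) :: e.2, q.1.2), 2 * q.2)
      else Path.cons n i s q)
    (Primrec.fst.comp Primrec.fst) (Path.primrec_cons n i s) ?_
  have h1 : Primrec fun q : ((Path × ℕ) × ℕ) × ((ℕ × List ℕ × ℕ) × Path) => q.2.1 :=
    Primrec.fst.comp Primrec.snd
  have h2 := Primrec.snd.comp h1
  refine Primrec.ite (Primrec.nat_le.comp (Primrec.const n) (Primrec.fst.comp h1))
    (Primrec.pair (Primrec.pair (Primrec.list_cons.comp ((Primrec.fst.comp h1).pair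
      ((Primrec.list_append.comp (Primrec.fst.comp h2) (Primrec.const [i])).pair
        (Primrec.snd.comp h2))) (Primrec.snd.comp Primrec.snd))
      (Primrec.snd.comp (Primrec.fst.comp Primrec.fst)))
      (Primrec.nat_double.comp (Primrec.snd.comp Primrec.fst)))
    ((Path.primrec_cons n i s).comp Primrec.fst)

theorem Path.prolong_eq_or (n i s : ℕ) (q : (Path × ℕ) × ℕ) :
    Path.prolong n i s q = Path.cons n i s q ∨
    ∃ m u t p, q.1.1 = (m, u, t) :: p ∧ n ≤ m ∧
      Path.prolong n i s q = (((m, u ++ [i], t) :: p, q.1.2), 2 * q.2) := by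
  obtain ⟨⟨_ | ⟨⟨m, u, t⟩, p⟩, a⟩, b⟩ := q
  · exact Or.inl rfl
  · by_cases h : n ≤ m
    · exact Or.inr ⟨m, u, t, p, rfl, h, if_pos h⟩
    · exact Or.inl (if_neg h)

theorem Path.prolong_injective (n i s : ℕ) : Function.Injective (Path.prolong n i s) := by
  rintro ⟨⟨p, a⟩, b⟩ ⟨⟨p', a'⟩, b'⟩ h
  rcases Path.prolong_eq_or n i s ((p, a), b) with h1 | ⟨m, u, t, r, h0, -, h1⟩ <;>
  rcases Path.prolong_eq_or n i s ((p', a'), b') with h2 | ⟨m', u', t', r', h0', -, h2⟩ <;>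
  rw [h1, h2] at h <;> simp only [Path.cons, Prod.mk.injEq, List.cons.injEq, true_and] at h
  · obtain ⟨⟨rfl, rfl⟩, h⟩ := h
    simp; omega
  · omega
  · omega
  · simp only at h0 h0'
    obtain ⟨⟨⟨⟨rfl, hu, rfl⟩, rfl⟩, rfl⟩, hb⟩ := h
    have := List.append_cancel_right hu
    subst h0 h0' this
    simp; omega

end Effective

section Coding

/-- The action of words on `X` determined by a sequence of maps. -/
def act {X : Type*} (f : ℕ → X → X) (u : List ℕ) (x : X) : X := u.foldr f x

theorem act_append {X : Type*} (f : ℕ → X → X) (u v : List ℕ) (x : X) :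
    act f (u ++ v) x = act f u (act f v x) := List.foldr_append

/-- The data used to code a countable Borel equivalence relation into many-one degrees: maps
`f i` enumerating the classes, an injection `hat` into reals carrying `E` into Turing
equivalence, a filtration `F` of Turing equivalence, and a sequence `c` of passwords. -/
structure Coding (X : Type*) [MeasurableSpace X] (E : X → X → Prop) where
  /-- maps enumerating the classes -/
  f : ℕ → X → X
  /-- the injection into the reals -/
  hat : X → ℕ → Bool
  /-- the filtration of Turing equivalence -/
  F : ℕ → (ℕ → Bool) → (ℕ → Bool) → Prop
  /-- the passwords -/
  c : ℕ → ℕ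
  equiv : Equivalence E
  meas_f : ∀ i, Measurable (f i)
  rel_iff : ∀ x y, E x y ↔ ∃ i, f i x = y
  meas_hat : Measurable hat
  hat_injective : Function.Injective hat
  hat_act : ∀ u x n, hat (act f u x) n = hat x (Nat.pair
    (Encodable.encode (Denumerable.ofNat (List ℕ) n.unpair.1 ++ u)) n.unpair.2)
  F_equiv : ∀ n, Equivalence (F n)
  F_meas : ∀ n, MeasurableSet {p : (ℕ → Bool) × (ℕ → Bool) | F n p.1 p.2}
  F_mono : ∀ n a b, F n a b → F (n + 1) a b
  F_exists : ∀ a b, TuringEquiv a b → ∃ n, F n a b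
  F_columns : ∀ n x y, TuringLE y x → (Set.range (column y)).Infinite →
    ¬ Set.range (column y) ⊆ {z | F n x z}
  password : ∀ r : ℕ → Path × ℕ, Computable r → ∀ K,
    (∀ N, ∃ n s, N ≤ n ∧ ∃ m, K ≤ m ∧ ∃ u, (n, u, s) ∈ (r m).1) →
    ∃ n s, s ≠ c n ∧ ∃ m, K ≤ m ∧ ∃ u, (n, u, s) ∈ (r m).1

namespace Coding

variable {X : Type*} [MeasurableSpace X] {E : X → X → Prop} (D : Coding X E)

theorem measurable_act (u : List ℕ) : Measurable (act D.f u) := by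
  induction u with
  | nil => exact measurable_id
  | cons i u ih => exact (D.meas_f i).comp ih

theorem rel_act (u : List ℕ) (x : X) : E x (act D.f u x) := by
  induction u with
  | nil => exact D.equiv.refl x
  | cons i u ih => exact D.equiv.trans ih ((D.rel_iff _ _).2 ⟨i, rfl⟩)

theorem turingLE_act {r : ℕ → List ℕ} (hr : Computable r) (x : X) :
    TuringLE (fun n => D.hat (act D.f (r n.unpair.1) x) n.unpair.2) (D.hat x) := by
  refine turingLE_of_computable (σ := fun n => Nat.pair (Encodable.encode
    (Denumerable.ofNat (List ℕ) n.unpair.2.unpair.1 ++ r n.unpair.1)) n.unpair.2.unpair.2) ?_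
    fun n => D.hat_act _ _ _
  have h1 : Computable fun n : ℕ => n.unpair.1 := (Primrec.fst.comp Primrec.unpair).to_comp
  have h2 : Computable fun n : ℕ => n.unpair.2 := (Primrec.snd.comp Primrec.unpair).to_comp
  exact Primrec₂.natPair.to_comp.comp
    (Computable.encode.comp (Primrec.list_append.to_comp.comp
      ((Computable.ofNat (List ℕ)).comp (h1.comp h2)) (hr.comp h1))) (h2.comp h2)

theorem turingLE_of_rel {x y : X} (h : E x y) : TuringLE (D.hat y) (D.hat x) := by
  obtain ⟨i, rfl⟩ := (D.rel_iff x y).1 h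
  refine turingLE_of_computable (σ := fun n => Nat.pair (Encodable.encode
    (Denumerable.ofNat (List ℕ) n.unpair.1 ++ [i])) n.unpair.2) ?_ fun n => D.hat_act [i] x n
  have h1 : Primrec fun n : ℕ => n.unpair.1 := Primrec.fst.comp Primrec.unpair
  have h2 : Primrec fun n : ℕ => n.unpair.2 := Primrec.snd.comp Primrec.unpair
  exact (Primrec₂.natPair.comp (Primrec.encode.comp (Primrec.list_append.comp
    ((Primrec.ofNat (List ℕ)).comp h1) (Primrec.const [i]))) h2).to_comp

theorem F_le {n m : ℕ} (h : n ≤ m) {a b : ℕ → Bool} (hab : D.F n a b) : D.F m a b := by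
  induction m, h using Nat.le_induction with
  | base => exact hab
  | succ m _ ih => exact D.F_mono m a b ih

theorem exists_F {x y : X} (h : E x y) : ∃ n, ∀ m, n ≤ m → D.F m (D.hat x) (D.hat y) := by
  obtain ⟨n, hn⟩ := D.F_exists _ _ ⟨D.turingLE_of_rel (D.equiv.symm h), D.turingLE_of_rel h⟩
  exact ⟨n, fun m hm => D.F_le hm hn⟩

/-- A path is valid at `y` if each of its steps `(n, u, s)` stays within an `F n`-class and has
the right password. -/
def Valid : Path → X → Prop
  | [], _ => True
  | e :: p, y => D.F e.1 (D.hat y) (D.hat (act D.f e.2.1 y)) ∧ e.2.2 = D.c e.1 ∧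
      Valid p (act D.f e.2.1 y)

/-- The end point of a path. -/
def last (p : Path) (y : X) : X := act D.f p.word y

theorem last_cons (e : ℕ × List ℕ × ℕ) (p : Path) (y : X) :
    D.last (e :: p) y = D.last p (act D.f e.2.1 y) := act_append _ _ _ _

theorem measurable_valid (p : Path) : Measurable (D.Valid p) := by
  induction p with
  | nil => exact measurable_const
  | cons e p ih =>
    refine Measurable.and ?_ (measurable_const.and (ih.comp (D.measurable_act e.2.1)))
    exact measurableSet_setOfPred.1 ((D.meas_hat.prodMk
      (D.meas_hat.comp (D.measurable_act e.2.1))) (D.F_meas e.1))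

theorem measurable_last (p : Path) : Measurable (D.last p) := D.measurable_act _

theorem Valid.F {N : ℕ} {p : Path} {y : X} (hp : D.Valid p y) (hN : ∀ e ∈ p, e.1 ≤ N) :
    D.F N (D.hat y) (D.hat (D.last p y)) := by
  induction p generalizing y with
  | nil => exact (D.F_equiv N).refl _
  | cons e p ih =>
    rw [last_cons]
    exact (D.F_equiv N).trans (D.F_le (hN e (by simp)) hp.1)
      (ih hp.2.2 fun e' he' => hN e' (by simp [he']))

theorem Valid.password_eq {p : Path} {y : X} (hp : D.Valid p y) :
    ∀ e ∈ p, e.2.2 = D.c e.1 := by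
  induction p generalizing y with
  | nil => simp
  | cons e p ih =>
    rintro e' (_ | ⟨_, he'⟩)
    · exact hp.2.1
    · exact ih hp.2.2 e' he'

variable (Z : X → Set ℕ)

/-- The atomic statement coded by a pair `q`: if the path is valid at `y`, then the number is in
the set attached to the end point. -/
def Holds (q : Path × ℕ) (y : X) : Prop := D.Valid q.1 y → q.2 ∈ Z (D.last q.1 y)

/-- The real attached to a point. -/
noncomputable def real (x : X) : ℕ → Bool :=
  fun k => decide (D.Holds Z (Denumerable.ofNat ((Path × ℕ) × ℕ) k).1 x)

variable {Z}

theorem measurable_real (hZ : ∀ n, Measurable fun x => n ∈ Z x) : Measurable (D.real Z) := by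
  refine measurable_pi_lambda _ fun k => ?_
  refine measurable_to_bool ?_
  have : (fun x => D.real Z x k) ⁻¹' {true} =
      {x | D.Holds Z (Denumerable.ofNat ((Path × ℕ) × ℕ) k).1 x} := by
    ext x; simp [real]
  rw [this]
  exact measurableSet_setOfPred.2 ((D.measurable_valid _).imp ((hZ _).comp (D.measurable_last _)))

theorem real_encode (x : X) (q : (Path × ℕ) × ℕ) :
    D.real Z x (Encodable.encode q) = decide (D.Holds Z q.1 x) := by
  rw [real, Denumerable.ofNat_encode]

theorem mem_iff_real (x : X) (m : ℕ) :
    m ∈ Z x ↔ D.real Z x (Encodable.encode ((([] : Path), m), 0)) = true := by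
  rw [real_encode]
  simp [Holds, Valid, last, Path.word, act]

theorem valid_cons_iff {y : X} {n i : ℕ} (hF : D.F n (D.hat y) (D.hat (D.f i y))) (p : Path) :
    D.Valid ((n, [i], D.c n) :: p) y ↔ D.Valid p (D.f i y) :=
  ⟨fun h => h.2.2, fun h => ⟨hF, rfl, h⟩⟩

theorem holds_prolong_iff {y : X} {n i : ℕ}
    (hF : ∀ m, n ≤ m → D.F m (D.hat y) (D.hat (D.f i y))) (q : (Path × ℕ) × ℕ) :
    D.Holds Z (Path.prolong n i (D.c n) q).1 y ↔ D.Holds Z q.1 (D.f i y) := by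
  rcases Path.prolong_eq_or n i (D.c n) q with h | ⟨m, u, t, p, h, hm, h'⟩
  · rw [h]
    unfold Holds Path.cons
    rw [D.valid_cons_iff (hF n le_rfl), last_cons]
    rfl
  · obtain ⟨⟨p', a⟩, b⟩ := q
    simp only at h
    subst h
    rw [h']
    unfold Holds
    simp only [last_cons, Valid, act_append]
    have h1 : act D.f [i] y = D.f i y := rfl
    have h2 : ∀ z, D.F m (D.hat y) z ↔ D.F m (D.hat (D.f i y)) z := fun z =>
      ⟨(D.F_equiv m).trans ((D.F_equiv m).symm (hF m hm)), (D.F_equiv m).trans (hF m hm)⟩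
    rw [h1, h2]

theorem oneLE_of_rel {x y : X} (h : E x y) : OneLE (D.real Z x) (D.real Z y) := by
  have h' := D.equiv.symm h
  obtain ⟨n, hn⟩ := D.exists_F h'
  obtain ⟨i, rfl⟩ := (D.rel_iff y x).1 h'
  refine ⟨fun k => Encodable.encode
    (Path.prolong n i (D.c n) (Denumerable.ofNat ((Path × ℕ) × ℕ) k)), ?_, ?_, fun k => ?_⟩
  · exact (Primrec.encode.comp ((Path.primrec_prolong n i (D.c n)).comp
      (Primrec.ofNat _))).to_comp
  · exact Encodable.encode_injective.comp ((Path.prolong_injective _ _ _).comp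
      (Denumerable.eqv ((Path × ℕ) × ℕ)).symm.injective)
  · rw [real_encode]
    unfold real
    exact decide_eq_decide.2 (D.holds_prolong_iff hn _).symm

theorem exists_reduction {x y : X} (h : MLE (D.real Z x) (D.real Z y)) :
    ∃ r : {r : ℕ → Path × ℕ // Computable r}, ∀ m, m ∈ Z x ↔ D.Holds Z (r.1 m) y := by
  obtain ⟨ρ, hρ, h⟩ := h
  refine ⟨⟨fun m => (Denumerable.ofNat ((Path × ℕ) × ℕ)
    (ρ (Encodable.encode ((([] : Path), m), 0)))).1, ?_⟩, fun m => ?_⟩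
  · refine Computable.fst.comp ((Computable.ofNat _).comp (hρ.comp (Computable.encode.comp ?_)))
    exact (((Primrec.const ([] : Path)).pair Primrec.id).pair (Primrec.const 0)).to_comp
  · rw [D.mem_iff_real, h]
    simp [real]

/-- The places where a reduction to the real attached to `y` uses an invalid path. -/
def invalid (r : ℕ → Path × ℕ) (y : X) : Set ℕ := {m | ¬ D.Valid (r m).1 y}

/-- The places where a reduction to the real attached to `f i w` uses a valid path leading
to `w`. -/
def pool (r : ℕ → Path × ℕ) (i : ℕ) (w : X) : Set ℕ :=
  {m | D.Valid (r m).1 (D.f i w) ∧ D.last (r m).1 (D.f i w) = w}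

theorem measurable_invalid (r : ℕ → Path × ℕ) (m : ℕ) :
    Measurable fun y => m ∈ D.invalid r y := (D.measurable_valid _).not

theorem measurable_eq_id (D : Coding X E) {α : X → X} (hα : Measurable α) :
    Measurable fun x => α x = x := by
  have e : (fun x => α x = x) = fun x => ∀ n, D.hat (α x) n = D.hat x n := by
    ext x
    rw [← D.hat_injective.eq_iff, funext_iff]
  rw [e]
  exact Measurable.forall fun n => measurableSet_setOfPred.1 (measurableSet_eq_fun
    ((measurable_pi_apply n).comp (D.meas_hat.comp hα)) ((measurable_pi_apply n).comp D.meas_hat))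

theorem measurable_pool (r : ℕ → Path × ℕ) (i m : ℕ) :
    Measurable fun w => m ∈ D.pool r i w :=
  ((D.measurable_valid _).comp (D.meas_f i)).and
    (D.measurable_eq_id ((D.measurable_last _).comp (D.meas_f i)))

theorem finite_range_last {r : ℕ → Path × ℕ} (hr : Computable r) {y : X}
    (hy : (D.invalid r y).Finite) : (Set.range fun m => D.last (r m).1 y).Finite := by
  obtain ⟨K, hK⟩ : ∃ K, ∀ m, K ≤ m → D.Valid (r m).1 y := by
    obtain ⟨K, hK⟩ := hy.bddAbove
    refine ⟨K + 1, fun m hm => ?_⟩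
    by_contra h
    have := hK h
    omega
  obtain ⟨N, hN⟩ : ∃ N, ∀ m, K ≤ m → ∀ e ∈ (r m).1, e.1 ≤ N := by
    by_contra! hcon
    obtain ⟨n, s, hs, m, hm, u, hu⟩ := D.password r hr K fun N => by
      obtain ⟨m, hm, ⟨n, u, s⟩, he, hn⟩ := hcon N
      exact ⟨n, s, hn.le, m, hm, u, he⟩
    exact hs ((hK m hm).password_eq D _ hu)
  have hfin : (Set.range fun m => D.last (r (m + K)).1 y).Finite := by
    have hcomp : Computable fun m => (r (m + K)).1.word :=
      Path.primrec_word.to_comp.comp (Computable.fst.comp (hr.comp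
        (Primrec.nat_add.comp Primrec.id (Primrec.const K)).to_comp))
    have hcol := D.turingLE_act hcomp y
    have hc : column (fun n => D.hat (act D.f (r (n.unpair.1 + K)).1.word y) n.unpair.2) =
        D.hat ∘ fun m => D.last (r (m + K)).1 y := by
      funext m k
      simp [column, last]
    by_contra hinf
    refine D.F_columns N _ _ hcol ?_ ?_
    · rw [hc, Set.range_comp]
      exact (Set.infinite_image_iff D.hat_injective.injOn).2 hinf
    · rw [hc]
      rintro _ ⟨m, rfl⟩
      exact (hK _ (Nat.le_add_left K m)).F D (hN _ (Nat.le_add_left K m))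
  refine (hfin.union ((Finset.range K).finite_toSet.image fun m => D.last (r m).1 y)).subset ?_
  rintro _ ⟨m, rfl⟩
  rcases lt_or_ge m K with h | h
  · exact Or.inr ⟨m, by simpa using h, rfl⟩
  · exact Or.inl ⟨m - K, by simp [Nat.sub_add_cancel h]⟩

theorem exists_infinite_pool {r : ℕ → Path × ℕ} (hr : Computable r) {x y : X}
    (h : ∀ m, m ∈ Z x ↔ D.Holds Z (r m) y) (hx : (Z x).Infinite)
    (hy : (D.invalid r y).Finite) :
    ∃ i w, E y w ∧ D.f i w = y ∧ (Z x ∩ D.pool r i w).Infinite ∧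
      ∀ m ∈ D.pool r i w, m ∈ Z x ↔ (r m).2 ∈ Z w := by
  obtain ⟨w, ⟨m, rfl⟩, hw⟩ : ∃ w ∈ Set.range fun m => D.last (r m).1 y,
      ((Z x \ D.invalid r y) ∩ {m | D.last (r m).1 y = w}).Infinite := by
    by_contra! hcon
    refine (hx.sdiff hy) (((D.finite_range_last hr hy).biUnion
      fun w hw => hcon w hw).subset fun m hm => ?_)
    exact Set.mem_biUnion ⟨m, rfl⟩ ⟨hm, rfl⟩
  set w := D.last (r m).1 y
  have hE : E y w := D.rel_act _ _
  obtain ⟨i, hi⟩ := (D.rel_iff w y).1 (D.equiv.symm hE)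
  refine ⟨i, w, hE, hi, hw.mono ?_, ?_⟩
  · rintro m ⟨⟨h1, h2⟩, h3⟩
    refine ⟨h1, ?_, ?_⟩
    · rw [hi]; exact not_not.1 h2
    · rw [hi]; exact h3
  · rintro m ⟨h1, h2⟩
    rw [hi] at h1 h2
    rw [h m]
    unfold Holds
    rw [h2]
    exact ⟨fun h => h h1, fun h _ => h⟩

end Coding

end Coding

theorem exists_sparse_generic_of_countable {X : Type*} [MeasurableSpace X] {hat : X → ℕ → Bool}
    {𝒮 : Set (X → Set ℕ)} (hc : 𝒮.Countable) (hS : ∀ S ∈ 𝒮, ∀ n, Measurable fun x => n ∈ S x)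
    {ℛ : Set ((X → Set ℕ) → Prop)} (hc' : ℛ.Countable) (hR : ∀ R ∈ ℛ, Forceable hat R) :
    ∃ Z : X → Set ℕ, (∀ n, Measurable fun x => n ∈ Z x) ∧ (∀ x, ∀ n ∈ Z x, Pref n (hat x)) ∧
      (∀ S ∈ 𝒮, ∀ x, (S x).Infinite →
        ∃ C, ∀ N, 2 * Nat.count (· ∈ Z x) N ≤ Nat.count (· ∈ S x) N + C) ∧
      ∀ R ∈ ℛ, R Z := by
  obtain ⟨S, hS'⟩ := (hc.insert fun _ => ∅).exists_eq_range (Set.insert_nonempty _ _)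
  obtain ⟨R, hR'⟩ := (hc'.insert fun _ => True).exists_eq_range (Set.insert_nonempty _ _)
  obtain ⟨Z, h1, h2, h3, h4⟩ := exists_sparse_generic (hat := hat) (S := S) (R := R) (by
    intro j
    have : S j ∈ insert (fun _ => ∅) 𝒮 := hS' ▸ Set.mem_range_self j
    rcases this with h | h
    · rw [h]; simp
    · exact hS _ h) (by
    intro i
    have : R i ∈ insert (fun _ => True) ℛ := hR' ▸ Set.mem_range_self i
    rcases this with h | h
    · rw [h]
      exact fun s => ⟨s, ⟨fun _ => le_rfl, fun _ _ _ => Iff.rfl, fun _ _ => Nat.le_add_right _ _⟩,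
        fun _ _ => trivial⟩
    · exact hR _ h)
  refine ⟨Z, h1, h2, fun T hT => ?_, fun T hT => ?_⟩
  · obtain ⟨j, rfl⟩ : T ∈ Set.range S := hS' ▸ Set.mem_insert_of_mem _ hT
    exact h3 j
  · obtain ⟨i, rfl⟩ : T ∈ Set.range R := hR' ▸ Set.mem_insert_of_mem _ hT
    exact h4 i

theorem count_le_of_subset {A B : Set ℕ} (h : A ⊆ B) (N : ℕ) :
    Nat.count (· ∈ A) N ≤ Nat.count (· ∈ B) N := by
  simp only [Nat.count_eq_card_filter_range]
  exact Finset.card_le_card (Finset.monotone_filter_right _ fun n _ hn => h hn)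

theorem not_count_bounded {A : Set ℕ} (hA : A.Infinite) (C : ℕ) :
    ¬ ∀ N, Nat.count (· ∈ A) N ≤ C := by
  intro h
  obtain ⟨L, hL⟩ := exists_le_count hA (C + 1)
  have := h L
  omega

namespace Coding

variable {X : Type*} [MeasurableSpace X] {E : X → X → Prop} (D : Coding X E)

theorem exists_limit [StandardBorelSpace X] [Nonempty X] {T : X → Set ℕ}
    (hT : ∀ n, Measurable fun x => n ∈ T x) :
    ∃ h : X → X, Measurable h ∧ ∀ w x, (∀ m ∈ T w, ∀ m' ∈ T w, ¬ Incompat m m') →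
      (∀ l, ∃ m ∈ T w, l ≤ m ∧ Pref m (D.hat x)) → h w = x := by
  obtain ⟨inv, hinv, hinv'⟩ :=
    (D.meas_hat.measurableEmbedding D.hat_injective).exists_measurable_extend measurable_id
      fun _ => inferInstance
  have hN : ∀ k : ℕ, ∃ N : X → ℕ, Measurable N ∧ ∀ x, (∃ n, n ∈ T x ∧ 2 ^ (k + 1) ≤ n) →
      N x ∈ T x ∧ 2 ^ (k + 1) ≤ N x := fun k =>
    exists_measurable_choice (p := fun n x => n ∈ T x ∧ 2 ^ (k + 1) ≤ n) fun n =>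
      (hT n).and measurable_const
  choose N hN hN' using hN
  refine ⟨fun w => inv fun k => (N k w).testBit k, hinv.comp (measurable_pi_lambda _ fun k =>
    (measurable_from_nat (f := fun n => n.testBit k)).comp (hN k)), fun w x hc hx => ?_⟩
  have e : (fun k => (N k w).testBit k) = D.hat x := by
    funext k
    obtain ⟨m, hm, hk, hp⟩ := hx (2 ^ (k + 1))
    obtain ⟨h1, h2⟩ := hN' k w ⟨m, hm, hk⟩
    by_contra hne
    refine hc _ h1 m hm ⟨k, h2, hk, fun h => hne (h.trans (hp k hk))⟩
  exact (congrArg inv e).trans (congrFun hinv' x)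

/-- The part of a pool where the reduction is at least `l` (and correct), or equal to `l`. -/
def subpool (r : ℕ → Path × ℕ) (i l : ℕ) (b : Bool) (w : X) : Set ℕ :=
  {m | m ∈ D.pool r i w ∧ (b = true → l ≤ (r m).2 ∧ Pref (r m).2 (D.hat w)) ∧
    (b = false → (r m).2 = l)}

theorem measurable_subpool (r : ℕ → Path × ℕ) (i l : ℕ) (b : Bool) (m : ℕ) :
    Measurable fun w => m ∈ D.subpool r i l b w :=
  (D.measurable_pool r i m).and ((measurable_const.imp (measurable_const.and
    (measurable_pref D.meas_hat _))).and measurable_const)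

theorem exists_subpool_converging {Z : X → Set ℕ} (hZ : ∀ x, ∀ n ∈ Z x, Pref n (D.hat x))
    {r : ℕ → Path × ℕ} {i : ℕ} {x w : X}
    (hinc : (∀ l, ∃ m ∈ D.pool r i w, ∃ m' ∈ D.pool r i w, l ≤ (r m).2 ∧ l ≤ (r m').2 ∧
        Pref (r m).2 (D.hat w) ∧ Pref (r m').2 (D.hat w) ∧ Incompat m m') →
      ∃ m ∈ D.pool r i w, ∃ m' ∈ D.pool r i w, Incompat m m' ∧ (r m).2 ∈ Z w ∧ (r m').2 ∈ Z w)
    (hinf : (Z x ∩ D.pool r i w).Infinite)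
    (h : ∀ m ∈ D.pool r i w, m ∈ Z x ↔ (r m).2 ∈ Z w) :
    ∃ l b, (∀ m ∈ D.subpool r i l b w, ∀ m' ∈ D.subpool r i l b w, ¬ Incompat m m') ∧
      ∀ l', ∃ m ∈ D.subpool r i l b w, l' ≤ m ∧ Pref m (D.hat x) := by
  have hl : ∃ l, ∀ m ∈ D.pool r i w, ∀ m' ∈ D.pool r i w, l ≤ (r m).2 → l ≤ (r m').2 →
      Pref (r m).2 (D.hat w) → Pref (r m').2 (D.hat w) → ¬ Incompat m m' := by
    by_contra! hcon
    obtain ⟨m, hm, m', hm', h1, h2, h3⟩ := hinc hcon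
    exact (hZ x m ((h m hm).2 h2)).not_incompat (hZ x m' ((h m' hm').2 h3)) h1
  obtain ⟨l, hl⟩ := hl
  have hlim : ∀ {I T : Set ℕ}, I.Infinite → I ⊆ Z x ∩ T → ∀ l', ∃ m ∈ T, l' ≤ m ∧
      Pref m (D.hat x) := by
    intro I T hI hIT l'
    obtain ⟨m, hm, hlm⟩ := hI.exists_gt l'
    exact ⟨m, (hIT hm).2, hlm.le, hZ x m (hIT hm).1⟩
  by_cases hbig : {m ∈ Z x ∩ D.pool r i w | l ≤ (r m).2}.Infinite
  · refine ⟨l, true, fun m hm m' hm' => ?_, hlim hbig ?_⟩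
    · exact hl m hm.1 m' hm'.1 (hm.2.1 rfl).1 (hm'.2.1 rfl).1 (hm.2.1 rfl).2 (hm'.2.1 rfl).2
    · rintro m ⟨⟨h1, h2⟩, h3⟩
      exact ⟨h1, h2, fun _ => ⟨h3, hZ w _ ((h m h2).1 h1)⟩, by simp⟩
  · have hsmall : ((Z x ∩ D.pool r i w) \ {m ∈ Z x ∩ D.pool r i w | l ≤ (r m).2}).Infinite :=
      hinf.sdiff (Set.not_infinite.1 hbig)
    obtain ⟨v, -, hv⟩ : ∃ v ∈ Finset.range l,
        {m ∈ Z x ∩ D.pool r i w | (r m).2 = v}.Infinite := by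
      by_contra! hcon
      refine hsmall (((Finset.range l).finite_toSet.biUnion fun v hv => hcon v hv).subset ?_)
      rintro m ⟨h1, h2⟩
      refine Set.mem_biUnion (x := (r m).2) ?_ ⟨h1, rfl⟩
      simpa using fun h3 => h2 ⟨h1, h3⟩
    obtain ⟨m₀, hm₀⟩ := hv.nonempty
    have hvZ : v ∈ Z w := hm₀.2 ▸ (h m₀ hm₀.1.2).1 hm₀.1.1
    have hsub : ∀ m ∈ D.subpool r i v false w, m ∈ Z x := fun m hm =>
      (h m hm.1).2 ((hm.2.2 rfl).symm ▸ hvZ)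
    refine ⟨v, false, fun m hm m' hm' => ?_, hlim hv ?_⟩
    · exact (hZ x m (hsub m hm)).not_incompat (hZ x m' (hsub m' hm'))
    · rintro m ⟨⟨h1, h2⟩, h3⟩
      exact ⟨h1, h2, by simp, fun _ => h3⟩

theorem exists_faithful [StandardBorelSpace X] [Nonempty X] :
    ∃ Z : X → Set ℕ, (∀ n, Measurable fun x => n ∈ Z x) ∧ (∀ x, ∀ n ∈ Z x, Pref n (D.hat x)) ∧
      (∀ x, (Z x).Infinite) ∧ ∀ x y, MEquiv (D.real Z x) (D.real Z y) → E x y := by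
  have hlim := fun κ : {r : ℕ → Path × ℕ // Computable r} × ℕ × ℕ × Bool =>
    D.exists_limit (D.measurable_subpool κ.1.1 κ.2.1 κ.2.2.1 κ.2.2.2)
  choose H hHm hH using hlim
  have := countable_computable (Path × ℕ)
  obtain ⟨Z, hZm, hZp, hZs, hZr⟩ := exists_sparse_generic_of_countable (hat := D.hat)
    (𝒮 := Set.range (fun r : {r : ℕ → Path × ℕ // Computable r} => D.invalid r.1) ∪
      Set.range (fun q : {r : ℕ → Path × ℕ // Computable r} ×
        ({r : ℕ → Path × ℕ // Computable r} × ℕ × ℕ × Bool) × ℕ =>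
        fun y => D.invalid q.1.1 (H q.2.1 (D.f q.2.2 y))))
    ((Set.countable_range _).union (Set.countable_range _)) (by
      rintro _ (⟨r, rfl⟩ | ⟨q, rfl⟩) n
      · exact D.measurable_invalid r.1 n
      · exact (D.measurable_invalid q.1.1 n).comp ((hHm _).comp (D.meas_f _)))
    (ℛ := Set.range (fun l : ℕ => fun Z => ∀ x, ∃ n ∈ Z x, l ≤ n) ∪
      (Set.range (fun q : {r : ℕ → Path × ℕ // Computable r} × ℕ => fun Z => ∀ x,
        (∀ l, ∃ m ∈ D.pool q.1.1 q.2 x, ∃ m' ∈ D.pool q.1.1 q.2 x, l ≤ (q.1.1 m).2 ∧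
          l ≤ (q.1.1 m').2 ∧ Pref (q.1.1 m).2 (D.hat x) ∧ Pref (q.1.1 m').2 (D.hat x) ∧
          Incompat m m') →
        ∃ m ∈ D.pool q.1.1 q.2 x, ∃ m' ∈ D.pool q.1.1 q.2 x, Incompat m m' ∧
          (q.1.1 m).2 ∈ Z x ∧ (q.1.1 m').2 ∈ Z x) ∪
      Set.range (fun q : ({r : ℕ → Path × ℕ // Computable r} × ℕ) ×
        (ℕ × ({r : ℕ → Path × ℕ // Computable r} × ℕ × ℕ × Bool) × ℕ) ×
        ({r : ℕ → Path × ℕ // Computable r} × ℕ × ℕ × Bool) × ℕ × Bool => fun Z => ∀ x,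
        D.hat x q.2.2.2.1 = q.2.2.2.2 →
        D.hat (D.f q.2.1.1 (H q.2.1.2.1 (D.f q.2.1.2.2 x))) q.2.2.2.1 ≠ q.2.2.2.2 →
        H q.2.2.1 (D.f q.2.1.1 (H q.2.1.2.1 (D.f q.2.1.2.2 x))) = x →
        (∀ l, ∃ m ∈ D.pool q.1.1.1 q.1.2 (D.f q.2.1.1 (H q.2.1.2.1 (D.f q.2.1.2.2 x))),
          l ≤ m ∧ Pref m (D.hat x)) →
        ∃ m ∈ D.pool q.1.1.1 q.1.2 (D.f q.2.1.1 (H q.2.1.2.1 (D.f q.2.1.2.2 x))),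
          ¬ (m ∈ Z x ↔ (q.1.1.1 m).2 ∈ Z (D.f q.2.1.1 (H q.2.1.2.1 (D.f q.2.1.2.2 x)))))))
    ((Set.countable_range _).union ((Set.countable_range _).union (Set.countable_range _))) (by
      rintro _ (⟨l, rfl⟩ | ⟨q, rfl⟩ | ⟨q, rfl⟩)
      · exact forceable_unbounded D.meas_hat l
      · exact forceable_incompat D.meas_hat (D.measurable_pool q.1.1 q.2) fun m => (q.1.1 m).2
      · exact forceable_diagonal D.meas_hat D.hat_injective (D.measurable_pool q.1.1.1 q.1.2)
          (fun m => (q.1.1.1 m).2) ((D.meas_f _).comp ((hHm _).comp (D.meas_f _))) (hHm q.2.2.1)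
          q.2.2.2.1 q.2.2.2.2)
  have hZi : ∀ x, (Z x).Infinite := fun x => Set.infinite_of_forall_exists_gt fun l => by
    obtain ⟨n, hn, hl⟩ := hZr _ (Or.inl ⟨l + 1, rfl⟩) x
    exact ⟨n, hn, by omega⟩
  refine ⟨Z, hZm, hZp, hZi, fun x y hxy => ?_⟩
  have key : ∀ {x y}, MLE (D.real Z x) (D.real Z y) →
      (∃ r : {r : ℕ → Path × ℕ // Computable r}, (D.invalid r.1 y).Infinite ∧
        D.invalid r.1 y ⊆ Z x) ∨
      ∃ (r : {r : ℕ → Path × ℕ // Computable r}) (i j : ℕ)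
        (κ : {r : ℕ → Path × ℕ // Computable r} × ℕ × ℕ × Bool), x = H κ (D.f j y) ∧
        (Z x ∩ D.pool r.1 i (D.f j y)).Infinite ∧
        ∀ m ∈ D.pool r.1 i (D.f j y), m ∈ Z x ↔ (r.1 m).2 ∈ Z (D.f j y) := by
    intro x y hle
    obtain ⟨r, hr⟩ := D.exists_reduction hle
    by_cases hinv : (D.invalid r.1 y).Infinite
    · exact Or.inl ⟨r, hinv, fun m hm => (hr m).2 fun h => absurd h hm⟩
    · obtain ⟨i, w, hE, -, hI, hw⟩ :=
        D.exists_infinite_pool r.2 hr (hZi x) (Set.not_infinite.1 hinv)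
      obtain ⟨j, rfl⟩ := (D.rel_iff y w).1 hE
      obtain ⟨l, b, h1, h2⟩ := D.exists_subpool_converging hZp
        (hZr _ (Or.inr (Or.inl ⟨(r, i), rfl⟩)) _) hI hw
      exact Or.inr ⟨r, i, j, (r, i, l, b), (hH (r, i, l, b) _ x h1 h2).symm, hI, hw⟩
  have mixed : ∀ {x y}, (∃ r : {r : ℕ → Path × ℕ // Computable r}, (D.invalid r.1 x).Infinite ∧
      D.invalid r.1 x ⊆ Z y) → ∀ j κ, x = H κ (D.f j y) → False := by
    rintro x y ⟨r, hr, hsub⟩ j κ hx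
    obtain ⟨C, hC⟩ := hZs _ (Or.inr ⟨(r, κ, j), rfl⟩) y (by simpa only [← hx] using hr)
    simp only [← hx] at hC
    refine not_count_bounded (hZi y) C fun N => ?_
    have h1 := hC N
    have h2 := count_le_of_subset hsub N
    omega
  rcases key hxy.1 with ⟨r, hr, hs⟩ | ⟨r, i, j, κ, hx, hI, hw⟩ <;>
    rcases key hxy.2 with ⟨r', hr', hs'⟩ | ⟨r', i', j', κ', hy, hI', hw'⟩
  · exfalso
    obtain ⟨C, hC⟩ := hZs _ (Or.inl ⟨r, rfl⟩) y hr
    obtain ⟨C', hC'⟩ := hZs _ (Or.inl ⟨r', rfl⟩) x hr'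
    simp only at hC hC'
    refine not_count_bounded (hZi x) (C + C') fun N => ?_
    have h1 := hC N
    have h2 := hC' N
    have h3 := count_le_of_subset hs N
    have h4 := count_le_of_subset hs' N
    omega
  · exact (mixed ⟨r, hr, hs⟩ j' κ' hy).elim
  · exact (mixed ⟨r', hr', hs'⟩ j κ hx).elim
  · by_contra hE
    have hne : D.hat x ≠ D.hat (D.f j y) := fun h =>
      hE (D.equiv.symm ((D.rel_iff y x).2 ⟨j, (D.hat_injective h).symm⟩))
    obtain ⟨k, hk⟩ := Function.ne_iff.1 hne
    have hdiag := hZr _ (Or.inr (Or.inr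
      ⟨((r, i), (j, κ', j'), κ, k, D.hat x k), rfl⟩)) x
    simp only [← hy] at hdiag
    obtain ⟨m, hm, hm'⟩ := hdiag trivial hk.symm hx.symm fun l => by
      obtain ⟨m, hm, hl⟩ := hI.exists_gt l
      exact ⟨m, hm.2, hl.le, hZp x m hm.1⟩
    exact hm' (hw m hm)

theorem real_injective {Z : X → Set ℕ} (hZp : ∀ x, ∀ n ∈ Z x, Pref n (D.hat x))
    (hZi : ∀ x, (Z x).Infinite) : Function.Injective (D.real Z) := by
  intro x y h
  refine D.hat_injective (funext fun k => ?_)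
  obtain ⟨m, hm, hk⟩ := (hZi x).exists_gt (2 ^ (k + 1))
  have hm' : m ∈ Z y := by
    rw [D.mem_iff_real, ← h, ← D.mem_iff_real]; exact hm
  exact (hZp x m hm k hk.le).symm.trans (hZp y m hm' k hk.le)

end Coding

theorem exists_coding (h : HyperRecFin) {X : Type*} [MeasurableSpace X] [StandardBorelSpace X]
    {E : X → X → Prop} (hE : Equivalence E) (hm : MeasurableSet {p : X × X | E p.1 p.2})
    (hc : ∀ x, {y | E x y}.Countable) : Nonempty (Coding X E) := by
  obtain ⟨F, hF1, hF2, hF3, hF4, hF5⟩ := h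
  obtain ⟨f, hf, hfE⟩ := exists_measurable_enumeration hE hm hc
  obtain ⟨code, hcode, hinj⟩ :=
    MeasurableSpace.measurable_injection_nat_bool_of_countablySeparated X
  have := countable_computable (Path × ℕ)
  obtain ⟨c, hc⟩ := exists_password
    fun q : {r : ℕ → Path × ℕ // Computable r} × ℕ =>
      {p : ℕ × ℕ | ∃ m, q.2 ≤ m ∧ ∃ u, (p.1, u, p.2) ∈ (q.1.1 m).1}
  have hmact : ∀ u, Measurable (act f u) := by
    intro u
    induction u with
    | nil => exact measurable_id
    | cons i u ih => exact (hf i).comp ih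
  exact ⟨{
    f := f
    hat := fun x n => code (act f (Denumerable.ofNat (List ℕ) n.unpair.1) x) n.unpair.2
    F := F
    c := c
    equiv := hE
    meas_f := hf
    rel_iff := hfE
    meas_hat := measurable_pi_lambda _ fun n =>
      (measurable_pi_apply _).comp (hcode.comp (hmact _))
    hat_injective := fun x y hxy => hinj <| funext fun k => by
      have := congrFun hxy (Nat.pair (Encodable.encode ([] : List ℕ)) k)
      simp only [Nat.unpair_pair, Denumerable.ofNat_encode] at this
      exact this
    hat_act := fun u x n => by
      simp only [Nat.unpair_pair, Denumerable.ofNat_encode, act_append]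
    F_equiv := hF1
    F_meas := hF2
    F_mono := hF3
    F_exists := fun a b => (hF4 a b).1
    F_columns := hF5
    password := fun r hr K hK => by
      obtain ⟨⟨n, s⟩, hp, hs⟩ := hc (⟨r, hr⟩, K) fun N => by
        obtain ⟨n, s, h1, h2⟩ := hK N
        exact ⟨(n, s), h2, h1⟩
      exact ⟨n, s, hs, hp⟩ }⟩

/-- Suppose Turing equivalence on `2^ω` is hyper-recursively-finite. Then many-one
equivalence `≡_m` and one-one equivalence `≡₁` on `2^ω` are universal countable Borel
equivalence relations: every countable Borel equivalence relation `E` on a standard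
Borel space `X` admits an injective Borel function `g : X → 2^ω` such that
`x_0 E x_1 ↔ g(x_0) ≡_m g(x_1) ↔ g(x_0) ≡₁ g(x_1)`. -/
theorem mEquiv_oneEquiv_universal (h : HyperRecFin) :
    ∀ (X : Type) [MeasurableSpace X] [StandardBorelSpace X] (E : X → X → Prop),
      Equivalence E →
      MeasurableSet {p : X × X | E p.1 p.2} →
      (∀ x, {y | E x y}.Countable) →
      ∃ g : X → ℕ → Bool, Measurable g ∧ Function.Injective g ∧
        ∀ x₀ x₁, (E x₀ x₁ ↔ MEquiv (g x₀) (g x₁)) ∧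
          (E x₀ x₁ ↔ OneEquiv (g x₀) (g x₁)) := by
  intro X _ _ E hE hm hc
  rcases isEmpty_or_nonempty X with hX | hX
  · exact ⟨fun x => hX.elim x, measurable_of_empty _, fun x => hX.elim x, fun x => hX.elim x⟩
  obtain ⟨D⟩ := exists_coding h hE hm hc
  obtain ⟨Z, hZm, hZp, hZi, hZ⟩ := D.exists_faithful
  have hone : ∀ {x y}, OneLE x y → MLE x y := fun ⟨ρ, h1, _, h2⟩ => ⟨ρ, h1, h2⟩
  have hrel : ∀ x y, E x y → OneEquiv (D.real Z x) (D.real Z y) := fun x y hxy =>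
    ⟨D.oneLE_of_rel hxy, D.oneLE_of_rel (hE.symm hxy)⟩
  have hmany : ∀ {x y}, OneEquiv x y → MEquiv x y := fun h => ⟨hone h.1, hone h.2⟩
  exact ⟨D.real Z, D.measurable_real hZm, D.real_injective hZp hZi, fun x y =>
    ⟨⟨fun h => hmany (hrel x y h), hZ x y⟩, ⟨hrel x y, fun h => hZ x y (hmany h)⟩⟩⟩

end SlamanSteel
end

section
/- Suppose Turing equivalence ≡_T on 2^ω is hyper-recursively-finite. Then there exists an injective Borel function f : 2^ω → 2^ω such that: x_0 ≡_T x_1 implies f(x_0) ≡₁ f(x_1); ¬(x_0 ≡_T x_1) implies ¬(f(x_0) ≡_m f(x_1)); and for every x ∈ 2^ω there does not exist an infinite sequence (x_i)_{i∈ω} of distinct reals with x_i ≡_T x for all i and f(x) ≥_m ⊕_i f(x_i). In particular, f is a Borel homomorphism from ≡_T to ≡_m which is not uniformly (≡_T, ≡_m)-invariant. -/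
open scoped Classical

namespace SlamanSteel

/-- Codes for the functionals generated by the clauses of `RecursiveIn`. -/
inductive OracleCode : Type
  | zero | succ | left | right | oracle
  | pair (a b : OracleCode)
  | comp (a b : OracleCode)
  | prec (a b : OracleCode)
  | rfind (a : OracleCode)
  deriving Countable

namespace OracleCode

/-- The partial function computed by a code from the oracle `O`. -/
noncomputable def eval (O : ℕ → ℕ) : OracleCode → ℕ →. ℕ
  | zero => pure 0
  | succ => fun n => Part.some (Nat.succ n)
  | left => fun n => Part.some (Nat.unpair n).1
  | right => fun n => Part.some (Nat.unpair n).2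
  | oracle => fun n => Part.some (O n)
  | pair a b => fun n => Nat.pair <$> eval O a n <*> eval O b n
  | comp a b => fun n => eval O b n >>= eval O a
  | prec a b => Nat.unpaired fun k n =>
      n.rec (eval O a k) fun y IH => do { let i ← IH; eval O b (Nat.pair k (Nat.pair y i)) }
  | rfind a => fun k => Nat.rfind fun n => (fun m => m = 0) <$> eval O a (Nat.pair k n)

theorem recursiveIn_eval (O : ℕ → ℕ) (c : OracleCode) : RecursiveIn O (eval O c) := by
  induction c with
  | zero => exact .zero
  | succ => exact .succ
  | left => exact .left
  | right => exact .right
  | oracle => exact .oracle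
  | pair a b iha ihb => exact .pair iha ihb
  | comp a b iha ihb => exact .comp iha ihb
  | prec a b iha ihb => exact .prec iha ihb
  | rfind a iha => exact .rfind iha

theorem exists_eval_eq {O : ℕ → ℕ} {f : ℕ →. ℕ} (hf : RecursiveIn O f) :
    ∃ c, eval O c = f := by
  induction hf with
  | zero => exact ⟨zero, rfl⟩
  | succ => exact ⟨succ, rfl⟩
  | left => exact ⟨left, rfl⟩
  | right => exact ⟨right, rfl⟩
  | oracle => exact ⟨oracle, rfl⟩
  | pair _ _ iha ihb =>
    obtain ⟨a, rfl⟩ := iha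
    obtain ⟨b, rfl⟩ := ihb
    exact ⟨pair a b, rfl⟩
  | comp _ _ iha ihb =>
    obtain ⟨a, rfl⟩ := iha
    obtain ⟨b, rfl⟩ := ihb
    exact ⟨comp a b, rfl⟩
  | prec _ _ iha ihb =>
    obtain ⟨a, rfl⟩ := iha
    obtain ⟨b, rfl⟩ := ihb
    exact ⟨prec a b, rfl⟩
  | rfind _ iha =>
    obtain ⟨a, rfl⟩ := iha
    exact ⟨rfind a, rfl⟩

theorem measurable_mem_eval (c : OracleCode) (n v : ℕ) :
    Measurable fun x : ℕ → Bool => v ∈ eval (oracleOf x) c n := by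
  induction c generalizing n v with
  | zero => simpa only [eval] using measurable_const
  | succ => simpa only [eval] using measurable_const
  | left => simpa only [eval] using measurable_const
  | right => simpa only [eval] using measurable_const
  | oracle =>
    have : (fun x : ℕ → Bool => v ∈ eval (oracleOf x) oracle n) =
        (fun b => v = cond b 1 0) ∘ fun x : ℕ → Bool => x n := by
      ext x
      simp [eval, oracleOf]
    rw [this]
    exact measurable_from_top.comp (measurable_pi_apply n)
  | pair a b iha ihb =>
    have : (fun x : ℕ → Bool => v ∈ eval (oracleOf x) (pair a b) n) = fun x =>
        ∃ i j, (i ∈ eval (oracleOf x) a n ∧ j ∈ eval (oracleOf x) b n) ∧ Nat.pair i j = v := by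
      ext x
      simp only [eval, Seq.seq, Part.mem_bind_iff]
      simp only [Part.map_eq_map, Part.mem_map_iff]
      constructor
      · rintro ⟨_, ⟨i, hi, rfl⟩, j, hj, rfl⟩
        exact ⟨i, j, ⟨hi, hj⟩, rfl⟩
      · rintro ⟨i, j, ⟨hi, hj⟩, rfl⟩
        exact ⟨_, ⟨i, hi, rfl⟩, j, hj, rfl⟩
    rw [this]
    exact .exists fun i => .exists fun j => ((iha n i).and (ihb n j)).and measurable_const
  | comp a b iha ihb =>
    have : (fun x : ℕ → Bool => v ∈ eval (oracleOf x) (comp a b) n) = fun x =>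
        ∃ i, i ∈ eval (oracleOf x) b n ∧ v ∈ eval (oracleOf x) a i := by
      ext x
      exact Part.mem_bind_iff
    rw [this]
    exact .exists fun i => (ihb n i).and (iha i v)
  | prec a b iha ihb =>
    have key : ∀ k m v, Measurable fun x : ℕ → Bool =>
        v ∈ (Nat.rec (eval (oracleOf x) a k)
          (fun y IH => do { let i ← IH; eval (oracleOf x) b (Nat.pair k (Nat.pair y i)) }) m :
          Part ℕ) := by
      intro k m
      induction m with
      | zero => exact fun v => iha k v
      | succ m ih =>
        intro v
        simp only [Part.bind_eq_bind, Part.mem_bind_iff]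
        exact .exists fun i => (ih i).and (ihb _ _)
    exact key _ _ v
  | rfind a iha =>
    have : (fun x : ℕ → Bool => v ∈ eval (oracleOf x) (rfind a) n) = fun x =>
        0 ∈ eval (oracleOf x) a (Nat.pair n v) ∧
          ∀ m, m < v → ∃ i, i ∈ eval (oracleOf x) a (Nat.pair n m) ∧ i ≠ 0 := by
      ext x
      refine Nat.mem_rfind.trans ?_
      simp
    rw [this]
    exact (iha _ _).and (.forall fun m => .imp measurable_const (.exists fun i =>
      (iha _ _).and measurable_const))

end OracleCode

theorem TuringLE.refl (x : ℕ → Bool) : TuringLE x x := RecursiveIn.oracle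

theorem measurable_decide {α : Type*} [MeasurableSpace α] {p : α → Prop} (hp : Measurable p) :
    Measurable fun a => decide (p a) :=
  (measurable_from_top (f := fun q : Prop => decide q)).comp hp

/-- There is a countable family of Borel functions whose graphs exhaust Turing equivalence. -/
theorem exists_functionals : ∃ φ : ℕ → (ℕ → Bool) → ℕ → Bool, (∀ d, Measurable (φ d)) ∧
    (∀ d x, TuringEquiv x (φ d x)) ∧ ∀ x y, TuringEquiv x y → ∃ d, φ d x = y := by
  obtain ⟨code, hcode⟩ : ∃ code : ℕ → OracleCode × OracleCode, Function.Surjective code :=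
    haveI : Nonempty (OracleCode × OracleCode) := ⟨(.zero, .zero)⟩
    exists_surjective_nat _
  let T : OracleCode → (ℕ → Bool) → ℕ → Bool := fun c x n => decide (1 ∈ c.eval (oracleOf x) n)
  let D : OracleCode × OracleCode → (ℕ → Bool) → Prop := fun c x => ∀ n,
    (0 ∈ c.1.eval (oracleOf x) n ∨ 1 ∈ c.1.eval (oracleOf x) n) ∧
      oracleOf x n ∈ c.2.eval (oracleOf (T c.1 x)) n
  have hT : ∀ c, Measurable (T c) := fun c =>
    measurable_pi_lambda _ fun n => measurable_decide (c.measurable_mem_eval n 1)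
  have hD : ∀ c, Measurable (D c) := by
    intro c
    refine .forall fun n => ((c.1.measurable_mem_eval n 0).or (c.1.measurable_mem_eval n 1)).and ?_
    have : (fun x => oracleOf x n ∈ c.2.eval (oracleOf (T c.1 x)) n) = fun x =>
        ∃ v, oracleOf x n = v ∧ v ∈ c.2.eval (oracleOf (T c.1 x)) n := by
      ext x
      simp
    rw [this]
    refine .exists fun v => .and ?_ ((c.2.measurable_mem_eval n v).comp (hT c.1))
    exact (measurable_from_top (f := fun b : Bool => cond b 1 0 = v)).comp (measurable_pi_apply n)
  refine ⟨fun d x => if D (code d) x then T (code d).1 x else x,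
    fun d => Measurable.ite (measurableSet_setOfPred.2 (hD _)) (hT _) measurable_id, fun d x => ?_,
    fun x y hxy => ?_⟩
  · by_cases h : D (code d) x
    · simp only [if_pos h]
      constructor
      · have : (code d).2.eval (oracleOf (T (code d).1 x)) = fun n => Part.some (oracleOf x n) :=
          funext fun n => Part.eq_some_iff.2 (h n).2
        rw [TuringLE, ← this]
        exact OracleCode.recursiveIn_eval _ _
      · have : (code d).1.eval (oracleOf x) =
            fun n => Part.some (oracleOf (T (code d).1 x) n) := by
          refine funext fun n => Part.eq_some_iff.2 ?_
          by_cases h1 : 1 ∈ (code d).1.eval (oracleOf x) n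
          · simp [oracleOf, T, h1]
          · simpa [oracleOf, T, h1] using (h n).1
        rw [TuringLE, ← this]
        exact OracleCode.recursiveIn_eval _ _
    · simp only [if_neg h]
      exact ⟨.refl x, .refl x⟩
  · obtain ⟨c, hc⟩ := OracleCode.exists_eval_eq hxy.2
    obtain ⟨c', hc'⟩ := OracleCode.exists_eval_eq hxy.1
    obtain ⟨d, hd⟩ := hcode (c, c')
    have hTx : T c x = y := by
      funext n
      simp only [T, hc, Part.mem_some_iff, oracleOf]
      cases y n <;> simp
    refine ⟨d, ?_⟩
    have : D (code d) x := by
      intro n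
      simp only [hd, hTx, hc, hc', Part.mem_some_iff, oracleOf, and_true]
      cases y n <;> simp
    simp only [if_pos this]
    rw [hd, hTx]

theorem RecursiveIn.of_computable {O : ℕ → ℕ} {f : ℕ → ℕ} (hf : Computable f) :
    RecursiveIn O fun n => Part.some (f n) :=
  .of_partrec (Partrec.nat_iff.1 hf)

theorem RecursiveIn.oracle_comp {O : ℕ → ℕ} {f : ℕ → ℕ} (hf : Computable f) :
    RecursiveIn O fun n => Part.some (O (f n)) := by
  simpa using RecursiveIn.oracle.comp (.of_computable hf)

theorem TuringLE.of_computable {x z : ℕ → Bool} {ρ : ℕ → ℕ} (hρ : Computable ρ)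
    (h : ∀ n, z n = x (ρ n)) : TuringLE z x := by
  have : oracleOf z = fun n => oracleOf x (ρ n) := funext fun n => by simp [oracleOf, h]
  rw [TuringLE, this]
  exact .oracle_comp hρ

/-- An unbounded search through the oracle followed by a query is recursive in the oracle. -/
theorem RecursiveIn.search {O y a q : ℕ → ℕ} (ha : Computable a) (hq : Computable q)
    (hex : ∀ m, ∃ d, O (a (Nat.pair m d)) = 1)
    (hy : ∀ m d, O (a (Nat.pair m d)) = 1 → y m = O (q (Nat.pair m d)))
    (hO : ∀ n, O n ≤ 1) : RecursiveIn O fun m => Part.some (y m) := by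
  have h1 : RecursiveIn O fun n => Part.some (1 - O (a n)) := by
    have hsub : Computable fun n : ℕ => 1 - n :=
      (Primrec.nat_sub.comp (.const 1) .id).to_comp
    simpa using (RecursiveIn.of_computable hsub).comp (.oracle_comp ha)
  have h2 := (RecursiveIn.oracle_comp hq).comp ((RecursiveIn.of_computable .id).pair h1.rfind)
  refine cast (congrArg _ (funext fun m => Part.eq_some_iff.2 ?_)) h2
  have hd := Nat.find_spec (hex m)
  have hmin := fun d => Nat.find_min (hex m) (m := d)
  generalize Nat.find (hex m) = d at hd hmin
  refine Part.mem_bind_iff.2 ⟨Nat.pair m d, ?_, by simpa using hy m d hd⟩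
  simp only [Seq.seq, Part.mem_bind_iff]
  refine ⟨Nat.pair m, by simp, ?_⟩
  simp only [Part.map_eq_map, Part.mem_map_iff]
  refine ⟨d, ?_, rfl⟩
  refine Nat.mem_rfind.2 ⟨by simp [hd], fun {d'} hd' => ?_⟩
  have := hmin d' hd'
  have := hO (a (Nat.pair m d'))
  simp
  omega

theorem oracleOf_le_one (x : ℕ → Bool) (n : ℕ) : oracleOf x n ≤ 1 := by
  unfold oracleOf
  cases x n <;> simp

theorem measurable_eq_real {α : Type*} [MeasurableSpace α] {f g : α → ℕ → Bool}
    (hf : Measurable f) (hg : Measurable g) : Measurable fun a => f a = g a :=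
  measurableSet_setOfPred.1 (measurableSet_eq_fun hf hg)

theorem mono_of_step {p : ℕ → Prop} (hp : ∀ n, p n → p (n + 1)) {m n : ℕ} (hmn : m ≤ n)
    (hm : p m) : p n := by
  induction n, hmn using Nat.le_induction with
  | base => exact hm
  | succ n _ ih => exact hp n ih

theorem HyperRecFin.trans (h : HyperRecFin) {x y z : ℕ → Bool} (hxy : TuringEquiv x y)
    (hyz : TuringEquiv y z) : TuringEquiv x z := by
  obtain ⟨F, hFeq, -, hFmono, hFE, -⟩ := h
  obtain ⟨m, hm⟩ := (hFE _ _).1 hxy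
  obtain ⟨n, hn⟩ := (hFE _ _).1 hyz
  exact (hFE _ _).2 ⟨max m n, (hFeq _).trans (mono_of_step (hFmono · _ _) (le_max_left m n) hm)
    (mono_of_step (hFmono · _ _) (le_max_right m n) hn)⟩

section Immune

variable (φ : ℕ → (ℕ → Bool) → ℕ → Bool) (s : ℕ → (ℕ → Bool) → ℕ → ℕ → Bool)

/-- A real coding all iterated images of `x` under `φ`, together with the indices by which `φ`
produces the terms of the sequences `s k`. -/
noncomputable def indexedJoin (x : ℕ → Bool) : ℕ → Bool := fun m =>
  let u := Denumerable.ofNat (List ℕ × ℕ × ℕ × ℕ) m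
  let z := u.1.foldl (fun z d => φ d z) x
  if u.2.1 = 0 then z u.2.2.1 else decide (s (u.2.1 - 1) z u.2.2.1 = φ u.2.2.2 z)

variable {φ s}

theorem indexedJoin_cons (x : ℕ → Bool) (d : ℕ) (L : List ℕ) (v : ℕ × ℕ × ℕ) :
    indexedJoin φ s (φ d x) (Encodable.encode (L, v)) =
      indexedJoin φ s x (Encodable.encode (d :: L, v)) := by
  simp only [indexedJoin, Denumerable.ofNat_encode, List.foldl_cons]

theorem indexedJoin_injective : Function.Injective (indexedJoin φ s) := by
  intro x y hxy
  funext i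
  simpa [indexedJoin, Denumerable.ofNat_encode] using
    congrFun hxy (Encodable.encode (([], 0, i, 0) : List ℕ × ℕ × ℕ × ℕ))

theorem measurable_foldl (hφ : ∀ d, Measurable (φ d)) (L : List ℕ) :
    Measurable fun x => L.foldl (fun z d => φ d z) x := by
  induction L with
  | nil => exact measurable_id
  | cons d L ih => exact ih.comp (hφ d)

theorem measurable_indexedJoin (hφ : ∀ d, Measurable (φ d))
    (hs : ∀ k i, Measurable fun x => s k x i) : Measurable (indexedJoin φ s) := by
  refine measurable_pi_lambda _ fun m => ?_
  unfold indexedJoin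
  generalize Denumerable.ofNat (List ℕ × ℕ × ℕ × ℕ) m = u
  have hz := measurable_foldl hφ u.1
  simp only
  split_ifs with hu
  · exact (measurable_pi_apply _).comp hz
  · exact (measurable_decide (measurable_eq_real (hs _ _) (hφ _))).comp hz

theorem computable_consIndex : Computable fun n : ℕ => Encodable.encode
    ((n.unpair.2 :: (Denumerable.ofNat (List ℕ × ℕ × ℕ × ℕ) n.unpair.1.unpair.2).1,
      (Denumerable.ofNat (List ℕ × ℕ × ℕ × ℕ) n.unpair.1.unpair.2).2) :
        List ℕ × ℕ × ℕ × ℕ) := by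
  have h1 : Primrec fun n : ℕ =>
      Denumerable.ofNat (List ℕ × ℕ × ℕ × ℕ) n.unpair.1.unpair.2 :=
    (Primrec.ofNat _).comp (Primrec.snd.comp (Primrec.unpair.comp
      (Primrec.fst.comp Primrec.unpair)))
  exact (Primrec.encode.comp (Primrec.pair (Primrec.list_cons.comp
    (Primrec.snd.comp Primrec.unpair) (Primrec.fst.comp h1)) (Primrec.snd.comp h1))).to_comp

theorem indexedJoin_turingLE (x : ℕ → Bool) (d : ℕ) :
    TuringLE (indexedJoin φ s (φ d x)) (indexedJoin φ s x) := by
  refine .of_computable (ρ := fun m => Encodable.encode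
    ((d :: (Denumerable.ofNat (List ℕ × ℕ × ℕ × ℕ) m).1,
      (Denumerable.ofNat (List ℕ × ℕ × ℕ × ℕ) m).2) : List ℕ × ℕ × ℕ × ℕ)) ?_ fun m => ?_
  · have h1 : Primrec fun m : ℕ => Denumerable.ofNat (List ℕ × ℕ × ℕ × ℕ) m := Primrec.ofNat _
    exact (Primrec.encode.comp (Primrec.pair (Primrec.list_cons.comp
      (Primrec.const d) (Primrec.fst.comp h1)) (Primrec.snd.comp h1))).to_comp
  · rw [← indexedJoin_cons, Prod.mk.eta, Denumerable.encode_ofNat]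

theorem join_indexedJoin_turingLE (hφ : ∀ x y, TuringEquiv x y → ∃ d, φ d x = y)
    (hsE : ∀ k x i, TuringEquiv x (s k x i)) (k : ℕ) (x : ℕ → Bool) :
    TuringLE (joinSeq fun i => indexedJoin φ s (s k x i)) (indexedJoin φ s x) := by
  have hval : ∀ i d, oracleOf (indexedJoin φ s x)
      (Encodable.encode (([], k + 1, i, d) : List ℕ × ℕ × ℕ × ℕ)) = 1 ↔ s k x i = φ d x := by
    intro i d
    simp only [oracleOf, indexedJoin, Denumerable.ofNat_encode]
    by_cases h : s k x i = φ d x <;> simp [h]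
  refine RecursiveIn.search (a := fun n => Encodable.encode
    (([], k + 1, n.unpair.1.unpair.1, n.unpair.2) : List ℕ × ℕ × ℕ × ℕ)) ?_ computable_consIndex
    (fun m => ?_) (fun m d hd => ?_) (oracleOf_le_one _)
  · exact (Primrec.encode.comp (Primrec.pair (Primrec.const []) (Primrec.pair (Primrec.const _)
      (Primrec.pair (Primrec.fst.comp (Primrec.unpair.comp (Primrec.fst.comp Primrec.unpair)))
        (Primrec.snd.comp Primrec.unpair))))).to_comp
  · obtain ⟨d, hd⟩ := hφ _ _ (hsE k x m.unpair.1)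
    exact ⟨d, (hval _ _).2 (by simp only [Nat.unpair_pair, hd])⟩
  · rw [hval] at hd
    simp only [Nat.unpair_pair] at hd
    simp only [oracleOf, joinSeq, Nat.unpair_pair, hd, ← indexedJoin_cons, Prod.mk.eta,
      Denumerable.encode_ofNat]

/-- If Turing equivalence is hyper-recursively-finite, then it is an increasing union of Borel
equivalence relations whose classes are immune to given sequences of Borel functions. -/
theorem HyperRecFin.exists_immune (h : HyperRecFin) (hφm : ∀ d, Measurable (φ d))
    (hφE : ∀ d x, TuringEquiv x (φ d x)) (hφ : ∀ x y, TuringEquiv x y → ∃ d, φ d x = y)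
    (hs : ∀ k i, Measurable fun x => s k x i)
    (hsE : ∀ k x i, TuringEquiv x (s k x i)) :
    ∃ F : ℕ → (ℕ → Bool) → (ℕ → Bool) → Prop, (∀ n, Equivalence (F n)) ∧
      (∀ n θ, Measurable θ → Measurable fun x => F n x (θ x)) ∧
      (∀ m n a b, m ≤ n → F m a b → F n a b) ∧
      (∀ a b, TuringEquiv a b ↔ ∃ n, F n a b) ∧
      (∀ n k x, (Set.range (s k x)).Infinite → ¬ Set.range (s k x) ⊆ {z | F n x z}) := by
  have hrefl : ∀ x, TuringEquiv x x := fun x => ⟨.refl x, .refl x⟩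
  have htrans : ∀ {x y z}, TuringEquiv x y → TuringEquiv y z → TuringEquiv x z := h.trans
  have hsymm : ∀ {x y}, TuringEquiv x y → TuringEquiv y x := And.symm
  obtain ⟨F, hFeq, hFm, hFmono, hFE, hF⟩ := h
  have hmono : ∀ a b m n, m ≤ n → F m a b → F n a b :=
    fun a b m n => mono_of_step (hFmono · a b)
  have hJ : ∀ {x y}, TuringEquiv x y →
      TuringEquiv (indexedJoin φ s x) (indexedJoin φ s y) := by
    intro x y hxy
    obtain ⟨d, hd⟩ := hφ _ _ hxy
    obtain ⟨e, he⟩ := hφ _ _ (hsymm hxy)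
    exact ⟨he ▸ indexedJoin_turingLE y e, hd ▸ indexedJoin_turingLE x d⟩
  have hJm := measurable_indexedJoin hφm hs
  refine ⟨fun n x y => TuringEquiv x y ∧ F n (indexedJoin φ s x) (indexedJoin φ s y),
    fun n => ⟨fun x => ⟨hrefl x, (hFeq n).refl _⟩, fun h => ⟨hsymm h.1, (hFeq n).symm h.2⟩,
      fun h h' => ⟨htrans h.1 h'.1, (hFeq n).trans h.2 h'.2⟩⟩,
    fun n θ hθ => .and ?_ ?_, fun m n a b hmn h => ⟨h.1, hmono _ _ _ _ hmn h.2⟩,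
    fun a b => ⟨fun h => ?_, fun ⟨n, h⟩ => h.1⟩, fun n k x hinf hsub => ?_⟩
  · have : (fun x => TuringEquiv x (θ x)) = fun x => ∃ d, φ d x = θ x :=
      funext fun x => propext ⟨hφ _ _, fun ⟨d, hd⟩ => hd ▸ hφE d x⟩
    rw [this]
    exact .exists fun d => measurable_eq_real (hφm d) hθ
  · exact measurableSet_setOfPred.1 ((hJm.prodMk (hJm.comp hθ)) (hFm n))
  · obtain ⟨n, hn⟩ := (hFE _ _).1 (hJ h)
    exact ⟨n, h, hn⟩
  · have hcol : column (joinSeq fun i => indexedJoin φ s (s k x i)) =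
        fun i => indexedJoin φ s (s k x i) := by
      funext i m
      simp [column, joinSeq]
    refine hF n (indexedJoin φ s x) _ (join_indexedJoin_turingLE hφ hsE k x) ?_ ?_
    · rw [hcol, Set.range_comp' (indexedJoin φ s) (s k x)]
      exact hinf.image indexedJoin_injective.injOn
    · rw [hcol]
      rintro _ ⟨i, rfl⟩
      exact (hsub ⟨i, rfl⟩).2

end Immune

theorem exists_infinite_avoiding {ι : Type*} [Countable ι] (R : ι → Set ℕ) :
    ∃ Q : Set ℕ, Q.Infinite ∧ 0 ∈ Q ∧ ∀ k, R k ⊆ Q → (R k).Finite := by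
  obtain ⟨e, he⟩ := exists_surjective_nat (Option ι)
  let R' : ℕ → Set ℕ := fun n => (e n).elim ∅ R
  have hg : ∀ k n, ∃ b, n ≤ b ∧ ((R' k).Infinite → n < b ∧ b ∈ R' k) := by
    intro k n
    by_cases h : (R' k).Infinite
    · obtain ⟨b, hb, hnb⟩ := h.exists_gt n
      exact ⟨b, hnb.le, fun _ => ⟨hnb, hb⟩⟩
    · exact ⟨n, le_rfl, fun h' => absurd h' h⟩
  choose g hg1 hg2 using hg
  let a : ℕ → ℕ := Nat.rec 0 fun k n => g k n + 1
  have ha : StrictMono a := strictMono_nat_of_lt_succ fun k => Nat.lt_succ_of_le (hg1 k (a k))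
  refine ⟨Set.range a, Set.infinite_range_of_injective ha.injective, ⟨0, rfl⟩, fun i hi => ?_⟩
  obtain ⟨k, hk⟩ := he (some i)
  have hR : R' k = R i := by simp [R', hk]
  by_contra hinf
  obtain ⟨hlt, hmem⟩ := hg2 k (a k) (by rwa [hR])
  obtain ⟨m, hm⟩ := hi (hR ▸ hmem)
  have h1 : k < m := ha.lt_iff_lt.1 (hm ▸ hlt)
  have h2 : m < k + 1 := ha.lt_iff_lt.1 (hm ▸ Nat.lt_succ_self (g k (a k)))
  omega

theorem measurable_comp_countable {α β γ : Type*} [MeasurableSpace α] [MeasurableSpace γ]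
    [Countable β] {f : α → β} (hf : ∀ b, Measurable fun x => f x = b) {a : β → α → γ}
    (ha : ∀ b, Measurable (a b)) : Measurable fun x => a (f x) x := by
  intro s hs
  have : (fun x => a (f x) x) ⁻¹' s = ⋃ b, {x | f x = b} ∩ a b ⁻¹' s := by
    ext x
    simp
  rw [this]
  exact .iUnion fun b => (measurableSet_setOfPred.2 (hf b)).inter (ha b hs)

/-- The list of the first `s` values of `p`. -/
def takeSeq (p : ℕ → ℕ) (s : ℕ) : List ℕ := (List.range s).map p

/-- The list `τ` is an initial segment of `p`. -/
def IsInit (τ : List ℕ) (p : ℕ → ℕ) : Prop := takeSeq p τ.length = τ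

@[simp]
theorem length_takeSeq (p : ℕ → ℕ) (s : ℕ) : (takeSeq p s).length = s := by
  simp [takeSeq]

theorem isInit_takeSeq (p : ℕ → ℕ) (s : ℕ) : IsInit (takeSeq p s) p := by
  simp [IsInit]

theorem takeSeq_injective (p : ℕ → ℕ) : Function.Injective (takeSeq p) := fun s t h => by
  simpa using congrArg List.length h

theorem getD_takeSeq (p : ℕ → ℕ) {s m : ℕ} (h : m < s) : (takeSeq p s).getD m 0 = p m := by
  simp [takeSeq, h]

theorem IsInit.getD {τ : List ℕ} {p : ℕ → ℕ} (h : IsInit τ p) {m : ℕ} (hm : m < τ.length) :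
    τ.getD m 0 = p m := by
  rw [← getD_takeSeq p hm, h]

theorem measurable_takeSeq_eq {α : Type*} [MeasurableSpace α] {g : α → ℕ → ℕ}
    (hg : Measurable g) (s : ℕ) (τ : List ℕ) : Measurable fun x => takeSeq (g x) s = τ := by
  have : (fun x => takeSeq (g x) s = τ) = fun x => ∀ i, (takeSeq (g x) s)[i]? = τ[i]? :=
    funext fun x => propext List.ext_getElem?_iff
  rw [this]
  refine .forall fun i => ?_
  by_cases hi : i < s
  · simp only [takeSeq, List.getElem?_map, List.getElem?_range hi, Option.map_some]
    exact (measurable_from_top (f := fun n => some n = τ[i]?)).comp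
      ((measurable_pi_apply i).comp hg)
  · simp only [takeSeq, List.getElem?_map, List.getElem?_eq_none_iff.2
      (List.length_range.trans_le (not_lt.1 hi)), Option.map_none]
    exact measurable_const

theorem measurable_isInit {α : Type*} [MeasurableSpace α] {g : α → ℕ → ℕ}
    (hg : Measurable g) (τ : List ℕ) : Measurable fun x => IsInit τ (g x) :=
  measurable_takeSeq_eq hg _ _

/-- The `m`th entry of the first list in `S` that has one, and `0` if there is no such list. -/
noncomputable def pick (S : Set (List ℕ)) (m : ℕ) : ℕ :=
  if h : ∃ c, Denumerable.ofNat (List ℕ) c ∈ S ∧ m < (Denumerable.ofNat (List ℕ) c).length then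
    (Denumerable.ofNat (List ℕ) (Nat.find h)).getD m 0
  else 0

theorem pick_eq {S : Set (List ℕ)} {p : ℕ → ℕ} {m : ℕ} (hS : ∀ τ ∈ S, IsInit τ p)
    (h : ∃ τ ∈ S, m < τ.length) : pick S m = p m := by
  have h' : ∃ c, Denumerable.ofNat (List ℕ) c ∈ S ∧
      m < (Denumerable.ofNat (List ℕ) c).length := by
    obtain ⟨τ, hτ, hm⟩ := h
    exact ⟨Encodable.encode τ, by simpa using ⟨hτ, hm⟩⟩
  rw [pick, dif_pos h']
  exact (hS _ (Nat.find_spec h').1).getD (Nat.find_spec h').2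

theorem exists_length_gt {S : Set (List ℕ)} {p : ℕ → ℕ} (hS : ∀ τ ∈ S, IsInit τ p)
    (hinf : S.Infinite) (m : ℕ) : ∃ τ ∈ S, m < τ.length := by
  by_contra! h
  refine hinf (((Set.finite_Iic m).image (takeSeq p)).subset fun τ hτ => ?_)
  exact ⟨τ.length, h τ hτ, hS τ hτ⟩

theorem pick_eq_of_infinite {S : Set (List ℕ)} {p : ℕ → ℕ} (hS : ∀ τ ∈ S, IsInit τ p)
    (hinf : S.Infinite) : pick S = p :=
  funext fun m => pick_eq hS (exists_length_gt hS hinf m)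

theorem measurable_pick {α : Type*} [MeasurableSpace α] {S : α → Set (List ℕ)}
    (hS : ∀ τ, Measurable fun x => τ ∈ S x) : Measurable fun x => pick (S x) := by
  refine measurable_pi_lambda _ fun m => ?_
  let P : α → ℕ → Prop := fun x c =>
    Denumerable.ofNat (List ℕ) c ∈ S x ∧ m < (Denumerable.ofNat (List ℕ) c).length
  have hP : ∀ c, Measurable fun x => P x c := fun c => (hS _).and measurable_const
  let k : α → Option ℕ := fun x => if h : ∃ c, P x c then some (Nat.find h) else none
  have hk : ∀ b, Measurable fun x => k x = b := by
    have : ∀ c, Measurable fun x => k x = some c := by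
      intro c
      have : (fun x => k x = some c) = fun x => P x c ∧ ∀ c', c' < c → ¬ P x c' := by
        funext x
        by_cases h : ∃ c, P x c
        · simp [k, h, Nat.find_eq_iff]
        · have h' : ∀ c, ¬ P x c := not_exists.1 h
          simp [k, h']
      rw [this]
      exact (hP c).and (.forall fun c' => .imp measurable_const (hP c').not)
    rintro (_ | c)
    · have : (fun x => k x = none) = fun x => ∀ c, ¬ P x c := by
        funext x
        simp [k]
      rw [this]
      exact .forall fun c => (hP c).not
    · exact this c
  have := measurable_comp_countable hk (γ := ℕ)
    (a := fun b _ => b.elim 0 fun c => (Denumerable.ofNat (List ℕ) c).getD m 0)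
    fun b => measurable_const
  convert this using 2 with x
  by_cases h : ∃ c, P x c
  · simp only [pick, k, dif_pos h, Option.elim_some]
    exact dif_pos h
  · simp only [pick, k, dif_neg h, Option.elim_none]
    exact dif_neg h

/-- The binary value of the first `m` bits of `x` preceded by a one. -/
def rank (x : ℕ → Bool) : ℕ → ℕ
  | 0 => 1
  | m + 1 => 2 * rank x m + (x m).toNat

theorem rank_pos (x : ℕ → Bool) (m : ℕ) : 0 < rank x m := by
  induction m with
  | zero => exact one_pos
  | succ m ih =>
    rw [rank]
    omega

theorem rank_strictMono (x : ℕ → Bool) : StrictMono (rank x) :=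
  strictMono_nat_of_lt_succ fun m => by
    have := rank_pos x m
    rw [rank]
    omega

theorem eq_of_rank_eq {x z : ℕ → Bool} {m n : ℕ} (h : rank x m = rank z n) :
    m = n ∧ ∀ i < m, x i = z i := by
  induction m generalizing n with
  | zero =>
    refine ⟨?_, fun i hi => absurd hi (Nat.not_lt_zero i)⟩
    by_contra hn
    exact ((rank_strictMono z) (Nat.pos_of_ne_zero (Ne.symm hn))).ne h
  | succ m ih =>
    cases n with
    | zero => exact absurd h ((rank_strictMono x) m.succ_pos).ne'
    | succ n =>
      have hb := (x m).toNat_le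
      have hb' := (z n).toNat_le
      simp only [rank] at h
      obtain ⟨rfl, hlt⟩ := ih (n := n) (by omega)
      have : (x m).toNat = (z m).toNat := by omega
      refine ⟨rfl, fun i hi => ?_⟩
      rcases Nat.lt_succ_iff_lt_or_eq.1 hi with hi | rfl
      · exact hlt i hi
      · revert this
        cases x i <;> cases z i <;> simp

theorem measurable_rank (m : ℕ) : Measurable fun x => rank x m := by
  induction m with
  | zero => exact measurable_const
  | succ m ih =>
    exact (ih.const_mul 2).add
      ((measurable_from_top (f := Bool.toNat)).comp (measurable_pi_apply m))

/-- `g x m` exceeds all entries `pick (S x λ) m`, where `λ` is an initial segment of `g (θ x)`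
determined at ranks below that of `(x, m)`. -/
def Dominates (g : (ℕ → Bool) → ℕ → ℕ) (θ : (ℕ → Bool) → ℕ → Bool)
    (S : (ℕ → Bool) → List ℕ → Set (List ℕ)) : Prop :=
  ∃ N, ∀ x m s, N ≤ m → (∀ i < s, rank (θ x) i < rank x m) →
    pick (S x (takeSeq (g (θ x)) s)) m < g x m

theorem exists_dominates {ι : Type*} [Countable ι] (θ : ι → (ℕ → Bool) → ℕ → Bool)
    (hθ : ∀ r, Measurable (θ r)) (S : ι → (ℕ → Bool) → List ℕ → Set (List ℕ))
    (hS : ∀ r τ τ', Measurable fun x => τ' ∈ S r x τ) :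
    ∃ g, Measurable g ∧ ∀ r, Dominates g (θ r) (S r) := by
  rcases isEmpty_or_nonempty ι with hι | hι
  · exact ⟨fun _ _ => 0, measurable_const, fun r => isEmptyElim r⟩
  obtain ⟨e, he⟩ := exists_surjective_nat ι
  let A : ((ℕ → Bool) → ℕ → ℕ) → ℕ → (ℕ → Bool) → ℕ → ℕ := fun g a x m =>
    ∑ r ∈ Finset.range (a + 1), ∑ s ∈ Finset.range (a + 1),
      pick (S (e r) x (takeSeq (g (θ (e r) x)) s)) m
  let G : ℕ → (ℕ → Bool) → ℕ → ℕ := Nat.rec (fun _ _ => 0) fun a g x m =>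
    if rank x m = a then 1 + A g a x m else g x m
  have hG : ∀ a x m, G (a + 1) x m = if rank x m = a then 1 + A (G a) a x m else G a x m :=
    fun _ _ _ => rfl
  have hGm : ∀ a, Measurable (G a) := by
    intro a
    induction a with
    | zero => exact measurable_const
    | succ a ih =>
      refine measurable_pi_lambda _ fun m => ?_
      refine Measurable.ite (measurable_rank m (measurableSet_singleton a)) ?_
        ((measurable_pi_apply m).comp ih)
      refine measurable_const.add (Finset.measurable_fun_sum _ fun r _ =>
        Finset.measurable_fun_sum _ fun s _ => ?_)
      exact measurable_comp_countable
        (f := fun x => takeSeq (G a (θ (e r) x)) s)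
        (a := fun τ x => pick (S (e r) x τ) m)
        (fun τ => measurable_takeSeq_eq (ih.comp (hθ _)) s τ)
        fun τ => (measurable_pi_apply m).comp (measurable_pick fun τ' => hS _ _ _)
  have hstable : ∀ x m b, rank x m < b → G b x m = G (rank x m + 1) x m := by
    intro x m b hb
    induction b, hb using Nat.le_induction with
    | base => rfl
    | succ b hb ih => rw [hG, if_neg (Nat.ne_of_lt hb), ih]
  refine ⟨fun x m => G (rank x m + 1) x m, measurable_pi_lambda _ fun m => ?_, fun i => ?_⟩
  · exact measurable_comp_countable (f := fun x => rank x m) (a := fun b x => G (b + 1) x m)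
      (fun b => measurableSet_setOfPred.1 (measurable_rank m (measurableSet_singleton b)))
      fun b => (measurable_pi_apply m).comp (hGm (b + 1))
  · obtain ⟨r, rfl⟩ := he i
    refine ⟨r, fun x m s hr hs => ?_⟩
    have hr' : r < rank x m + 1 := Nat.lt_succ_of_le (hr.trans ((rank_strictMono x).le_apply))
    have hs' : s < rank x m + 1 := by
      rcases s with _ | s
      · omega
      · have := hs s s.lt_succ_self
        have := (rank_strictMono (θ (e r) x)).le_apply (x := s)
        omega
    have htake : takeSeq (fun m => G (rank (θ (e r) x) m + 1) (θ (e r) x) m) s =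
        takeSeq (G (rank x m) (θ (e r) x)) s :=
      List.map_congr_left fun i hi => (hstable _ _ _ (hs i (List.mem_range.1 hi))).symm
    rw [htake]
    refine Nat.lt_of_lt_of_eq ?_ ((hG (rank x m) x m).trans (if_pos rfl)).symm
    refine Nat.lt_of_le_of_lt ?_ (Nat.lt_add_of_pos_left one_pos)
    exact (Finset.single_le_sum
      (f := fun s => pick (S (e r) x (takeSeq (G (rank x m) (θ (e r) x)) s)) m)
      (fun _ _ => Nat.zero_le _) (Finset.mem_range.2 hs')).trans
      (Finset.single_le_sum (f := fun r => ∑ s ∈ Finset.range (rank x m + 1),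
        pick (S (e r) x (takeSeq (G (rank x m) (θ (e r) x)) s)) m)
      (fun _ _ => Nat.zero_le _) (Finset.mem_range.2 hr'))

/-- Indices of bits: a path of pairs `(n, d)`, a stage and a finite sequence. -/
abbrev Index := List (ℕ × ℕ) × ℕ × List ℕ

/-- The largest first coordinate of a step of `L`. -/
def topStep : List (ℕ × ℕ) → ℕ
  | [] => 0
  | p :: L => max p.1 (topStep L)

/-- The endpoint of the path `L` starting at `x`. -/
def endpoint (φ : ℕ → (ℕ → Bool) → ℕ → Bool) (x : ℕ → Bool) (L : List (ℕ × ℕ)) : ℕ → Bool :=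
  L.foldl (fun z p => φ p.2 z) x

theorem measurable_endpoint {φ : ℕ → (ℕ → Bool) → ℕ → Bool} (hφ : ∀ d, Measurable (φ d))
    (L : List (ℕ × ℕ)) : Measurable fun x => endpoint φ x L := by
  induction L with
  | nil => exact measurable_id
  | cons p L ih => exact ih.comp (hφ p.2)

/-- A decomposition of Turing equivalence into an increasing union of Borel equivalence relations
`F n`, and an infinite set `Q` of natural numbers, which are both immune to the family `read`. -/
structure Frame {C : Type} (read : C × ℕ → List ℕ → Index) where
  φ : ℕ → (ℕ → Bool) → ℕ → Bool
  measurable_φ : ∀ d, Measurable (φ d)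
  equiv_φ : ∀ d x, TuringEquiv x (φ d x)
  exists_φ : ∀ x y, TuringEquiv x y → ∃ d, φ d x = y
  F : ℕ → (ℕ → Bool) → (ℕ → Bool) → Prop
  equivalence_F : ∀ n, Equivalence (F n)
  measurable_F : ∀ n θ, Measurable θ → Measurable fun x => F n x (θ x)
  mono_F : ∀ m n a b, m ≤ n → F m a b → F n a b
  equiv_iff : ∀ a b, TuringEquiv a b ↔ ∃ n, F n a b
  finite_endpoint : ∀ n c t y,
    (∀ τ, t ≤ Encodable.encode τ → F n y (endpoint φ y (read c τ).1)) →
    ((fun τ => endpoint φ y (read c τ).1) '' {τ | t ≤ Encodable.encode τ}).Finite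
  finite_recurrent : ∀ n c y,
    (∀ z i, {τ | endpoint φ y (read (c, i) τ).1 = z}.Infinite → F n y z) →
    {z | ∃ i, {τ | endpoint φ y (read (c, i) τ).1 = z}.Infinite}.Finite
  Q : Set ℕ
  infinite_Q : Q.Infinite
  zero_mem_Q : 0 ∈ Q
  finite_top : ∀ c t, (∀ τ, t ≤ Encodable.encode τ → topStep (read c τ).1 ∈ Q) →
    ((fun τ => topStep (read c τ).1) '' {τ | t ≤ Encodable.encode τ}).Finite
  finite_stage : ∀ c t, (∀ τ, t ≤ Encodable.encode τ → (read c τ).2.1 ∈ Q) →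
    ((fun τ => (read c τ).2.1) '' {τ | t ≤ Encodable.encode τ}).Finite
  finite_recurrentTop : ∀ c,
    (∀ n i, {τ | topStep (read (c, i) τ).1 = n}.Infinite → n ∈ Q) →
    {n | ∃ i, {τ | topStep (read (c, i) τ).1 = n}.Infinite}.Finite

theorem infinite_iff_exists_encode {S : Set (List ℕ)} :
    S.Infinite ↔ ∀ t, ∃ τ, t ≤ Encodable.encode τ ∧ τ ∈ S := by
  rw [← Set.infinite_image_iff (f := Encodable.encode) Encodable.encode_injective.injOn,
    Set.infinite_iff_exists_gt]
  refine ⟨fun h t => ?_, fun h t => ?_⟩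
  · obtain ⟨_, ⟨τ, hτ, rfl⟩, ht⟩ := h t
    exact ⟨τ, ht.le, hτ⟩
  · obtain ⟨τ, ht, hτ⟩ := h (t + 1)
    exact ⟨_, ⟨τ, hτ, rfl⟩, ht⟩

theorem HyperRecFin.nonempty_frame (h : HyperRecFin) {C : Type} [Countable C]
    (read : C × ℕ → List ℕ → Index) : Nonempty (Frame read) := by
  obtain ⟨φ, hφm, hφE, hφ⟩ := exists_functionals
  have hend : ∀ x L, TuringEquiv x (endpoint φ x L) := by
    intro x L
    induction L generalizing x with
    | nil => exact ⟨.refl x, .refl x⟩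
    | cons p L ih => exact h.trans (hφE p.2 x) (ih _)
  obtain ⟨e, he⟩ := exists_surjective_nat (Option (((C × ℕ) × ℕ) ⊕ C))
  let s : Option (((C × ℕ) × ℕ) ⊕ C) → (ℕ → Bool) → ℕ → ℕ → Bool := fun k y i =>
    match k with
    | none => y
    | some (.inl (c, t)) =>
      if t ≤ i then endpoint φ y (read c (Denumerable.ofNat (List ℕ) i)).1 else y
    | some (.inr c) =>
      let u := Denumerable.ofNat (ℕ × List ℕ) i
      let z := endpoint φ y (read (c, u.1) u.2).1
      if {τ | endpoint φ y (read (c, u.1) τ).1 = z}.Infinite then z else y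
  have hs : ∀ k i, Measurable fun y => s k y i := by
    rintro (_ | ⟨c, t⟩ | c) i
    · exact measurable_id
    · simp only [s]
      split_ifs
      · exact measurable_endpoint hφm _
      · exact measurable_id
    · simp only [s]
      refine Measurable.ite (measurableSet_setOfPred.2 ?_) (measurable_endpoint hφm _)
        measurable_id
      simp only [infinite_iff_exists_encode]
      exact .forall fun t => .exists fun τ => measurable_const.and
        (measurable_eq_real (measurable_endpoint hφm _) (measurable_endpoint hφm _))
  have hsE : ∀ k y i, TuringEquiv y (s k y i) := by
    have hrefl : ∀ y, TuringEquiv y y := fun y => ⟨.refl y, .refl y⟩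
    rintro (_ | ⟨c, t⟩ | c) y i
    · exact hrefl y
    · simp only [s]
      split_ifs
      · exact hend _ _
      · exact hrefl y
    · simp only [s]
      split_ifs
      · exact hend _ _
      · exact hrefl y
  obtain ⟨F, hFeq, hFm, hFmono, hFE, hF⟩ := h.exists_immune (s := fun k => s (e k)) hφm hφE hφ
    (fun k => hs (e k)) fun k => hsE (e k)
  have hF' : ∀ n k x, Set.range (s k x) ⊆ {z | F n x z} → (Set.range (s k x)).Finite := by
    intro n k x hsub
    obtain ⟨k, rfl⟩ := he k
    exact Set.not_infinite.1 fun hinf => hF n k x hinf hsub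
  obtain ⟨Q, hQinf, hQ0, hQ⟩ := exists_infinite_avoiding
    (ι := ((C × ℕ) × ℕ) ⊕ ((C × ℕ) × ℕ) ⊕ C) fun k => match k with
      | .inl (c, t) => (fun τ => topStep (read c τ).1) '' {τ | t ≤ Encodable.encode τ}
      | .inr (.inl (c, t)) => (fun τ => (read c τ).2.1) '' {τ | t ≤ Encodable.encode τ}
      | .inr (.inr c) => {n | ∃ i, {τ | topStep (read (c, i) τ).1 = n}.Infinite}
  refine ⟨{
    φ := φ
    measurable_φ := hφm
    equiv_φ := hφE
    exists_φ := hφ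
    F := F
    equivalence_F := hFeq
    measurable_F := hFm
    mono_F := hFmono
    equiv_iff := hFE
    finite_endpoint := fun n c t y hsub => ?_
    finite_recurrent := fun n c y hsub => ?_
    Q := Q
    infinite_Q := hQinf
    zero_mem_Q := hQ0
    finite_top := fun c t hsub => hQ (.inl (c, t)) ?_
    finite_stage := fun c t hsub => hQ (.inr (.inl (c, t))) ?_
    finite_recurrentTop := fun c hsub => hQ (.inr (.inr c)) ?_ }⟩
  · refine (hF' n (some (.inl (c, t))) y ?_).subset ?_
    · rintro _ ⟨i, rfl⟩
      simp only [s, Set.mem_ofPred_eq]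
      split_ifs with hi
      · exact hsub _ (by simpa using hi)
      · exact (hFeq n).refl y
    · rintro _ ⟨τ, hτ, rfl⟩
      refine ⟨Encodable.encode τ, ?_⟩
      simp only [s, Denumerable.ofNat_encode]
      exact if_pos hτ
  · refine (hF' n (some (.inr c)) y ?_).subset ?_
    · rintro _ ⟨i, rfl⟩
      simp only [s, Set.mem_ofPred_eq]
      split_ifs with hi
      · exact hsub _ _ hi
      · exact (hFeq n).refl y
    · rintro z ⟨i, hi⟩
      obtain ⟨τ, rfl⟩ := hi.nonempty
      refine ⟨Encodable.encode (i, τ), ?_⟩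
      simp only [s, Denumerable.ofNat_encode]
      exact if_pos hi
  · rintro _ ⟨τ, hτ, rfl⟩
    exact hsub τ hτ
  · rintro _ ⟨τ, hτ, rfl⟩
    exact hsub τ hτ
  · rintro n ⟨i, hi⟩
    exact hsub n i hi

/-- The restriction of a sequence to indices below `J`. -/
def trunc {α : Type*} [Zero α] (J : ℕ) (H : ℕ → α) : ℕ → α := fun j => if j < J then H j else 0

theorem trunc_of_lt {α : Type*} [Zero α] {J j : ℕ} (H : ℕ → α) (h : j < J) :
    trunc J H j = H j :=
  if_pos h

theorem exists_seq_of_step {α : Type*} [Zero α] {A : α → Prop} (hA : A 0)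
    {p : ℕ → (ℕ → α) → α → Prop} (h : ∀ J H, (∀ j, A (H j)) → ∃ g, A g ∧ p J H g) :
    ∃ G : ℕ → α, (∀ j, A (G j)) ∧ ∀ J, p J (trunc J G) (G J) := by
  choose! g hgA hgp using h
  let H : ℕ → ℕ → α := Nat.rec (fun _ => 0) fun J H => Function.update H J (g J H)
  have hsucc : ∀ J, H (J + 1) = Function.update (H J) J (g J (H J)) := fun _ => rfl
  have hH : ∀ J, H J = trunc J fun j => g j (H j) := by
    intro J
    induction J with
    | zero => funext j; simp [trunc, H]
    | succ J ih =>
      funext j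
      rw [hsucc]
      rcases lt_trichotomy j J with hj | rfl | hj
      · rw [Function.update_of_ne hj.ne, ih, trunc_of_lt _ hj, trunc_of_lt _ (by omega)]
      · rw [Function.update_self, trunc_of_lt _ (by omega)]
      · rw [Function.update_of_ne hj.ne', ih]
        simp [trunc, show ¬ j < J by omega, show ¬ j < J + 1 by omega]
  have hHA : ∀ J j, A (H J j) := by
    intro J
    induction J with
    | zero => exact fun _ => hA
    | succ J ih =>
      intro j
      rw [hsucc, Function.update_apply]
      split_ifs
      · exact hgA J _ ih
      · exact ih j
  exact ⟨fun j => g j (H j), fun j => hgA j _ (hHA j),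
    fun J => hH J ▸ hgp J _ (hHA J)⟩

/-- The real whose bits record the nonzero values of `p`. -/
noncomputable def toReal (p : ℕ → ℕ) : ℕ → Bool := fun k => decide (p k ≠ 0)

theorem measurable_toReal : Measurable toReal :=
  measurable_pi_lambda _ fun k =>
    (measurable_from_top (f := fun n : ℕ => decide (n ≠ 0))).comp (measurable_pi_apply k)

/-- Names for the basic operations on reals: applying a functional, or decoding a real from
the list of its initial segments provided by a reading. -/
inductive Letter (ι : Type) : Type
  | app (d : ℕ)
  | bad (c : ι)
  | fiber (c : ι) (L : List (ℕ × ℕ)) (j : ℕ)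
  deriving Countable

/-- Names for the families of sets of lists to be dominated. -/
inductive Task (ι : Type) : Type
  | bad (c : ι)
  | fiber (c : ι) (L : List (ℕ × ℕ)) (j : ℕ)
  | value (c : ι) (L : List (ℕ × ℕ)) (j : ℕ) (τ : List ℕ)
  | preimage (w' : List (Letter ι)) (c : ι) (j : ℕ)
  | entry (c : ι)
  | label (w' : List (Letter ι)) (c : ι)
  deriving Countable

namespace Frame

variable {C : Type} {read : C × ℕ → List ℕ → Index} (P : Frame read)

/-- Every step of the path `L` from `x` has the form `(n, d)` with `n ∈ Q` and stays within a class
of `F n`. -/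
def Valid : (ℕ → Bool) → List (ℕ × ℕ) → Prop
  | _, [] => True
  | x, p :: L => (p.1 ∈ P.Q ∧ P.F p.1 x (P.φ p.2 x)) ∧ Valid (P.φ p.2 x) L

/-- The index `u` is admissible at `x`. -/
def Ok (x : ℕ → Bool) (u : Index) : Prop := P.Valid x u.1 ∧ u.2.1 ∈ P.Q

/-- The endpoint of the path `L` starting at `x`. -/
abbrev tail (x : ℕ → Bool) (L : List (ℕ × ℕ)) : ℕ → Bool := endpoint P.φ x L

/-- The truth value coded at `u` in the real assigned to `x`. -/
def Val (G : ℕ → (ℕ → Bool) → ℕ → ℕ) (x : ℕ → Bool) (u : Index) : Prop :=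
  P.Ok x u ∧ ¬ IsInit u.2.2 (G u.2.1 (P.tail x u.1))

/-- The lists which the reading `c` sends to inadmissible indices at `y`. -/
def badSet (c : C × ℕ) (y : ℕ → Bool) : Set (List ℕ) := {τ | ¬ P.Ok y (read c τ)}

/-- The lists which the reading `c` sends to initial segments of `H j` at the endpoint of `L`. -/
def fiberSet (H : ℕ → (ℕ → Bool) → ℕ → ℕ) (c : C × ℕ) (L : List (ℕ × ℕ)) (j : ℕ)
    (y : ℕ → Bool) : Set (List ℕ) :=
  {τ | P.tail y (read c τ).1 = P.tail y L ∧ (read c τ).2.1 = j ∧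
    IsInit (read c τ).2.2 (H j (P.tail y L))}

/-- The operation on reals named by a letter. -/
noncomputable def act (H : ℕ → (ℕ → Bool) → ℕ → ℕ) : Letter (C × ℕ) → (ℕ → Bool) → ℕ → Bool
  | .app d => P.φ d
  | .bad c => fun y => toReal (pick (P.badSet c y))
  | .fiber c L j => fun y => toReal (pick (P.fiberSet H c L j y))

/-- The operation on reals named by a word. -/
noncomputable def word (H : ℕ → (ℕ → Bool) → ℕ → ℕ) (w : List (Letter (C × ℕ)))
    (x : ℕ → Bool) : ℕ → Bool :=
  w.foldl (fun y b => P.act H b y) x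

/-- The family of sets of lists named by a task at stage `J`, relative to the word `w`. -/
def taskSet (H : ℕ → (ℕ → Bool) → ℕ → ℕ) (J : ℕ) (w : List (Letter (C × ℕ))) :
    Task (C × ℕ) → (ℕ → Bool) → List ℕ → Set (List ℕ)
  | .bad c => fun x _ => P.badSet c (P.word H w x)
  | .fiber c L j => fun x _ => P.fiberSet H c L j (P.word H w x)
  | .value c L j τ₀ => fun x _ => {τ | P.tail (P.word H w x) (read c τ).1 =
      P.tail (P.word H w x) L ∧ (read c τ).2.1 = j ∧ (read c τ).2.2 = τ₀}
  | .preimage w' c j => fun z _ => {τ' | ∃ τ, (IsInit τ (H j (P.word H w z)) ∧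
      P.Ok (P.word H w' z) (read c τ)) ∧ P.tail (P.word H w' z) (read c τ).1 = z ∧
      (read c τ).2.1 = J ∧ (read c τ).2.2 = τ'}
  | .entry c => fun _ τ => {(read c τ).2.2}
  | .label w' c => fun x τ' => {τ | P.tail (P.word H w' x) (read c τ).1 = P.word H w x ∧
      (read c τ).2.1 = J ∧ (read c τ).2.2 = τ'}

variable {P}

theorem measurable_valid (L : List (ℕ × ℕ)) : Measurable fun x => P.Valid x L := by
  induction L with
  | nil => exact measurable_const
  | cons p L ih =>
    exact (measurable_const.and (P.measurable_F _ _ (P.measurable_φ _))).and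
      (ih.comp (P.measurable_φ _))

theorem measurable_ok (u : Index) : Measurable fun x => P.Ok x u :=
  (measurable_valid _).and measurable_const

theorem measurable_tail (L : List (ℕ × ℕ)) : Measurable fun x => P.tail x L :=
  measurable_endpoint P.measurable_φ L

theorem measurable_val {G : ℕ → (ℕ → Bool) → ℕ → ℕ} (hG : ∀ j, Measurable (G j)) (u : Index) :
    Measurable fun x => P.Val G x u :=
  (measurable_ok u).and (measurable_isInit ((hG _).comp (measurable_tail _)) _).not

theorem measurable_badSet (c : C × ℕ) (τ : List ℕ) : Measurable fun y => τ ∈ P.badSet c y :=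
  (measurable_ok _).not

theorem measurable_fiberSet {H : ℕ → (ℕ → Bool) → ℕ → ℕ} (hH : ∀ j, Measurable (H j))
    (c : C × ℕ) (L : List (ℕ × ℕ)) (j : ℕ) (τ : List ℕ) :
    Measurable fun y => τ ∈ P.fiberSet H c L j y :=
  (measurable_eq_real (measurable_tail _) (measurable_tail _)).and
    (measurable_const.and (measurable_isInit ((hH _).comp (measurable_tail _)) _))

theorem measurable_act {H : ℕ → (ℕ → Bool) → ℕ → ℕ} (hH : ∀ j, Measurable (H j))
    (b : Letter (C × ℕ)) : Measurable (P.act H b) := by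
  cases b with
  | app d => exact P.measurable_φ d
  | bad c => exact measurable_toReal.comp (measurable_pick (measurable_badSet c))
  | fiber c L j => exact measurable_toReal.comp (measurable_pick (measurable_fiberSet hH c L j))

theorem measurable_word {H : ℕ → (ℕ → Bool) → ℕ → ℕ} (hH : ∀ j, Measurable (H j))
    (w : List (Letter (C × ℕ))) : Measurable (P.word H w) := by
  induction w with
  | nil => exact measurable_id
  | cons b w ih => exact ih.comp (measurable_act hH b)

theorem measurable_taskSet {H : ℕ → (ℕ → Bool) → ℕ → ℕ} (hH : ∀ j, Measurable (H j)) (J : ℕ)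
    (w : List (Letter (C × ℕ))) (T : Task (C × ℕ)) (τ τ' : List ℕ) :
    Measurable fun x => τ' ∈ P.taskSet H J w T x τ := by
  have hw := fun w => measurable_word (P := P) hH w
  have ht := fun w L => (measurable_tail (P := P) L).comp (hw w)
  cases T with
  | bad c => exact (measurable_badSet c τ').comp (hw w)
  | fiber c L j => exact (measurable_fiberSet hH c L j τ').comp (hw w)
  | value c L j τ₀ =>
    exact (measurable_eq_real (ht w _) (ht w _)).and measurable_const
  | preimage w' c j =>
    exact .exists fun σ => ((measurable_isInit ((hH j).comp (hw w)) σ).and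
      ((measurable_ok _).comp (hw w'))).and
      ((measurable_eq_real (ht w' _) measurable_id).and measurable_const)
  | entry c => exact measurable_const
  | label w' c => exact (measurable_eq_real (ht w' _) (hw w)).and measurable_const

variable (P)

theorem exists_hierarchy [Countable C] : ∃ G : ℕ → (ℕ → Bool) → ℕ → ℕ,
    (∀ j, Measurable (G j)) ∧ (∀ x k, G 0 x k = (x k).toNat) ∧
    ∀ J, 0 < J → ∀ w T, Dominates (G J) (P.word (trunc J G) w) (P.taskSet (trunc J G) J w T) := by
  let p : ℕ → (ℕ → (ℕ → Bool) → ℕ → ℕ) → ((ℕ → Bool) → ℕ → ℕ) → Prop := fun J H g =>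
    (J = 0 → ∀ x k, g x k = (x k).toNat) ∧
      (0 < J → ∀ w T, Dominates g (P.word H w) (P.taskSet H J w T))
  have hp : ∀ J H, (∀ j, Measurable (H j)) → ∃ g, Measurable g ∧ p J H g := by
    intro J H hH
    rcases Nat.eq_zero_or_pos J with rfl | hJ
    · exact ⟨fun x k => (x k).toNat, measurable_pi_lambda _ fun k =>
        (measurable_from_top (f := Bool.toNat)).comp (measurable_pi_apply k),
        fun _ _ _ => rfl, fun h => absurd h (lt_irrefl 0)⟩
    · obtain ⟨g, hgm, hg⟩ := exists_dominates
        (ι := List (Letter (C × ℕ)) × Task (C × ℕ)) (fun r => P.word H r.1)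
        (fun r => measurable_word hH r.1) (fun r => P.taskSet H J r.1 r.2)
        fun r => measurable_taskSet hH J r.1 r.2
      exact ⟨g, hgm, fun h => absurd h hJ.ne', fun _ w T => hg (w, T)⟩
  obtain ⟨G, hGm, hG⟩ := exists_seq_of_step measurable_const hp
  exact ⟨G, hGm, (hG 0).1 rfl, fun J => (hG J).2⟩

end Frame

theorem Dominates.not_infinite {g : (ℕ → Bool) → ℕ → ℕ} {θ : (ℕ → Bool) → ℕ → Bool}
    {S : (ℕ → Bool) → List ℕ → Set (List ℕ)} (h : Dominates g θ S) {x : ℕ → Bool}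
    {A : Set (List ℕ)} (hA : ∀ τ ∈ A, IsInit τ (g x)) (hS : S x [] = A) : A.Finite := by
  by_contra hinf
  obtain ⟨N, hN⟩ := h
  have := hN x N 0 le_rfl fun i hi => absurd hi (Nat.not_lt_zero i)
  rw [show takeSeq (g (θ x)) 0 = [] from rfl, hS, pick_eq_of_infinite hA hinf] at this
  exact this.false

theorem exists_encode_bound {S : Set (List ℕ)} (hS : S.Finite) :
    ∃ t, ∀ τ, t ≤ Encodable.encode τ → τ ∉ S := by
  by_contra! h
  exact infinite_iff_exists_encode.2 h hS

theorem finite_range_of_finite_image {α : Type*} {f : List ℕ → α} {t : ℕ}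
    (h : (f '' {τ | t ≤ Encodable.encode τ}).Finite) : (Set.range f).Finite := by
  have h' : {τ : List ℕ | Encodable.encode τ < t}.Finite :=
    (Set.finite_Iio t).preimage Encodable.encode_injective.injOn
  refine (h.union (h'.image f)).subset ?_
  rintro _ ⟨τ, rfl⟩
  rcases le_or_gt t (Encodable.encode τ) with ht | ht
  · exact .inl ⟨τ, ht, rfl⟩
  · exact .inr ⟨τ, ht, rfl⟩

namespace Frame

variable {C : Type} {read : C × ℕ → List ℕ → Index} {P : Frame read}

theorem equivalence (P : Frame read) : Equivalence TuringEquiv where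
  refl x := ⟨.refl x, .refl x⟩
  symm := And.symm
  trans {x y z} hxy hyz := by
    obtain ⟨m, hm⟩ := (P.equiv_iff _ _).1 hxy
    obtain ⟨n, hn⟩ := (P.equiv_iff _ _).1 hyz
    exact (P.equiv_iff _ _).2 ⟨max m n, (P.equivalence_F _).trans
      (P.mono_F _ _ _ _ (le_max_left m n) hm) (P.mono_F _ _ _ _ (le_max_right m n) hn)⟩

theorem equiv_tail (x : ℕ → Bool) (L : List (ℕ × ℕ)) : TuringEquiv x (P.tail x L) := by
  induction L generalizing x with
  | nil => exact P.equivalence.refl x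
  | cons p L ih => exact P.equivalence.trans (P.equiv_φ p.2 x) (ih _)

theorem Valid.topStep_mem {x : ℕ → Bool} {L : List (ℕ × ℕ)} (h : P.Valid x L) :
    topStep L ∈ P.Q := by
  induction L generalizing x with
  | nil => exact P.zero_mem_Q
  | cons p L ih =>
    rcases max_choice p.1 (topStep L) with hm | hm
    · exact Set.mem_of_eq_of_mem hm h.1.1
    · exact Set.mem_of_eq_of_mem hm (ih h.2)

theorem Valid.F_topStep {x : ℕ → Bool} {L : List (ℕ × ℕ)} (h : P.Valid x L) :
    P.F (topStep L) x (P.tail x L) := by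
  induction L generalizing x with
  | nil => exact (P.equivalence_F _).refl x
  | cons p L ih =>
    exact (P.equivalence_F _).trans (P.mono_F _ _ _ _ (le_max_left _ _) h.1.2)
      (P.mono_F _ _ _ _ (le_max_right _ _) (ih h.2))

theorem finite_range_of_finite_badSet {c : C × ℕ} {y : ℕ → Bool} (h : (P.badSet c y).Finite) :
    (Set.range fun τ => (P.tail y (read c τ).1, (read c τ).2.1)).Finite ∧
      (Set.range fun τ => topStep (read c τ).1).Finite := by
  obtain ⟨t, ht⟩ := exists_encode_bound h
  have hok : ∀ τ, t ≤ Encodable.encode τ → P.Ok y (read c τ) :=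
    fun τ hτ => not_not.1 (ht τ hτ)
  have htop := P.finite_top c t fun τ hτ => (hok τ hτ).1.topStep_mem
  obtain ⟨M, hM⟩ := htop.bddAbove
  have hend := P.finite_endpoint M c t y fun τ hτ =>
    P.mono_F _ _ _ _ (hM ⟨τ, hτ, rfl⟩) (hok τ hτ).1.F_topStep
  have hstage := P.finite_stage c t fun τ hτ => (hok τ hτ).2
  refine ⟨((finite_range_of_finite_image hend).prod
    (finite_range_of_finite_image hstage)).subset ?_, finite_range_of_finite_image htop⟩
  rintro _ ⟨τ, rfl⟩
  exact ⟨⟨τ, rfl⟩, ⟨τ, rfl⟩⟩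

/-- The initial segments of `p` are decoded from the real assigned to `y` via the family `c`. -/
def Reads (P : Frame read) (G : ℕ → (ℕ → Bool) → ℕ → ℕ) (c : C × ℕ) (y : ℕ → Bool)
    (p : ℕ → ℕ) : Prop :=
  ∀ τ, ¬ IsInit τ p ↔ P.Val G y (read c τ)

/-- The initial segments of `p` which `c` sends to admissible indices of stage `j` whose path
leads to `z`. -/
def fiberAt (P : Frame read) (c : C × ℕ) (y : ℕ → Bool) (p : ℕ → ℕ) (z : ℕ → Bool) (j : ℕ) :
    Set (List ℕ) :=
  {τ | (IsInit τ p ∧ P.Ok y (read c τ)) ∧ P.tail y (read c τ).1 = z ∧ (read c τ).2.1 = j}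

theorem exists_infinite_fiberAt {c : C × ℕ} {y : ℕ → Bool} (h : (P.badSet c y).Finite)
    (p : ℕ → ℕ) : ∃ z j, (P.fiberAt c y p z j).Infinite := by
  by_contra! hfin
  have hinf : {τ | IsInit τ p}.Infinite :=
    (Set.infinite_range_of_injective (takeSeq_injective p)).mono
      (Set.range_subset_iff.2 (isInit_takeSeq p))
  refine (hinf.sdiff h) (Set.Finite.of_finite_fibers
    (fun τ => (P.tail y (read c τ).1, (read c τ).2.1))
    ((finite_range_of_finite_badSet h).1.subset (Set.image_subset_range _ _)) ?_)
  rintro ⟨z, j⟩ -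
  refine (hfin z j).subset ?_
  rintro τ ⟨⟨hτ, hok⟩, heq⟩
  exact ⟨⟨hτ, not_not.1 hok⟩, congrArg Prod.fst heq, congrArg Prod.snd heq⟩

section Reads

variable {G : ℕ → (ℕ → Bool) → ℕ → ℕ} {c : C × ℕ} {y : ℕ → Bool} {p : ℕ → ℕ}

theorem Reads.isInit_of_mem_badSet (h : P.Reads G c y p) : ∀ τ ∈ P.badSet c y, IsInit τ p :=
  fun τ hτ => by_contra fun hn => hτ ((h τ).1 hn).1

theorem Reads.isInit_of_isInit_read (h : P.Reads G c y p) {τ : List ℕ}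
    (hτ : IsInit (read c τ).2.2 (G (read c τ).2.1 (P.tail y (read c τ).1))) : IsInit τ p :=
  by_contra fun hn => ((h τ).1 hn).2 hτ

theorem Reads.isInit_read (h : P.Reads G c y p) {τ : List ℕ} (hτ : IsInit τ p)
    (hok : P.Ok y (read c τ)) :
    IsInit (read c τ).2.2 (G (read c τ).2.1 (P.tail y (read c τ).1)) :=
  by_contra fun hn => (h τ).2 ⟨hok, hn⟩ hτ

/-- A real whose bits are decoded from the real assigned to `y` is the image of `y` under one of
the named operations, at all sufficiently large stages. -/
theorem Reads.exists_act {x : ℕ → Bool} (h0 : ∀ k, G 0 x k = (x k).toNat)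
    (h : P.Reads G c y (G 0 x)) :
    ∃ b J, ∀ J', J ≤ J' → P.act (trunc J' G) b y = x := by
  have htoReal : toReal (G 0 x) = x := by
    funext k
    simp only [toReal, h0]
    cases x k <;> simp
  by_cases hfin : (P.badSet c y).Finite
  · obtain ⟨z, j, hinf⟩ := exists_infinite_fiberAt hfin (G 0 x)
    obtain ⟨τ₁, h₁⟩ := hinf.nonempty
    refine ⟨.fiber c (read c τ₁).1 j, j + 1, fun J' hJ' => ?_⟩
    change toReal (pick (P.fiberSet (trunc J' G) c (read c τ₁).1 j y)) = x
    rw [pick_eq_of_infinite (p := G 0 x) ?_ ?_, htoReal]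
    · rintro τ ⟨hz, hj, hτ⟩
      rw [trunc_of_lt G (Nat.lt_of_succ_le hJ'), ← hz, ← hj] at hτ
      exact h.isInit_of_isInit_read hτ
    · refine hinf.mono ?_
      rintro τ ⟨⟨hτ, hok⟩, hz, hj⟩
      refine ⟨hz.trans h₁.2.1.symm, hj, ?_⟩
      rw [trunc_of_lt G (Nat.lt_of_succ_le hJ'), h₁.2.1, ← hz, ← hj]
      exact h.isInit_read hτ hok
  · refine ⟨.bad c, 0, fun J' _ => ?_⟩
    change toReal (pick (P.badSet c y)) = x
    rw [pick_eq_of_infinite h.isInit_of_mem_badSet hfin, htoReal]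

/-- A reading of `G J x` from the real assigned to `y` essentially passes through indices whose
path leads from `y` to `x`. -/
theorem Reads.eq_of_infinite {J : ℕ} (hJ : 0 < J) {x : ℕ → Bool}
    (hG : ∀ J, 0 < J → ∀ w T,
      Dominates (G J) (P.word (trunc J G) w) (P.taskSet (trunc J G) J w T))
    (hxy : ∀ J', J ≤ J' → ∃ w, P.word (trunc J' G) w x = y)
    (hyx : ∀ J', J ≤ J' → ∃ w, P.word (trunc J' G) w y = x)
    (h : P.Reads G c y (G J x)) :
    (P.badSet c y).Finite ∧ ∀ z j, (P.fiberAt c y (G J x) z j).Infinite → z = x := by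
  obtain ⟨w, hw⟩ := hxy J le_rfl
  refine ⟨(hG J hJ w (.bad c)).not_infinite h.isInit_of_mem_badSet (by simp only [taskSet, hw]),
    fun z j hinf => by_contra fun hzx => ?_⟩
  obtain ⟨τ₁, h₁⟩ := hinf.nonempty
  have hyz : TuringEquiv y z := h₁.2.1 ▸ equiv_tail y _
  obtain ⟨d, hd⟩ := P.exists_φ _ _ hyz
  obtain ⟨e, he⟩ := P.exists_φ _ _ (P.equivalence.symm hyz)
  have hread : ∀ τ ∈ P.fiberAt c y (G J x) z j, IsInit (read c τ).2.2 (G j z) := by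
    rintro τ ⟨⟨hτ, hok⟩, rfl, rfl⟩
    exact h.isInit_read hτ hok
  have hinit : ∀ τ, P.tail y (read c τ).1 = z → (read c τ).2.1 = j →
      IsInit (read c τ).2.2 (G j z) → IsInit τ (G J x) := by
    rintro τ rfl rfl hτ
    exact h.isInit_of_isInit_read hτ
  have hvalue : ∀ τ₀, (P.fiberAt c y (G J x) z j ∩ (fun τ => (read c τ).2.2) ⁻¹' {τ₀}).Finite := by
    intro τ₀
    by_contra hfib
    obtain ⟨τ₂, h₂, rfl⟩ := Set.Infinite.nonempty hfib
    refine Set.Infinite.mono (t := {τ | P.tail y (read c τ).1 = P.tail y (read c τ₁).1 ∧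
      (read c τ).2.1 = j ∧ (read c τ).2.2 = (read c τ₂).2.2}) ?_ hfib
      ((hG J hJ w (.value c (read c τ₁).1 j (read c τ₂).2.2)).not_infinite (x := x) ?_
        (by simp only [taskSet, hw]))
    · rintro τ ⟨hτ, hv⟩
      exact ⟨hτ.2.1.trans h₁.2.1.symm, hτ.2.2, hv⟩
    · rintro τ ⟨hz, hj, hv⟩
      exact hinit τ (hz.trans h₁.2.1) hj (hv ▸ hread τ₂ h₂)
  have hlabels : ((fun τ => (read c τ).2.2) '' P.fiberAt c y (G J x) z j).Infinite := fun hfin =>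
    hinf (Set.Finite.of_finite_fibers _ hfin fun τ₀ _ => hvalue τ₀)
  rcases lt_trichotomy j J with hj | rfl | hj
  · refine Set.Infinite.mono (t := P.fiberSet (trunc J G) c (read c τ₁).1 j y) ?_ hinf
      ((hG J hJ w (.fiber c (read c τ₁).1 j)).not_infinite (x := x) ?_ (by simp only [taskSet, hw]))
    · intro τ hτ
      refine ⟨hτ.2.1.trans h₁.2.1.symm, hτ.2.2, ?_⟩
      rw [trunc_of_lt G hj, h₁.2.1]
      exact hread τ hτ
    · rintro τ ⟨hz, hj', hτ⟩
      rw [trunc_of_lt G hj, h₁.2.1] at hτ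
      exact hinit τ (hz.trans h₁.2.1) hj' hτ
  · obtain ⟨w', hw'⟩ := hyx j le_rfl
    have hzx' : P.word (trunc j G) (.app e :: w') z = x := by
      rw [← hw', ← he]
      rfl
    have hxz' : P.word (trunc j G) (w ++ [.app d]) x = z := by
      rw [← hd, ← hw, word, List.foldl_append]
      rfl
    obtain ⟨N₁, hN₁⟩ := hG j hJ (.app e :: w') (.entry c)
    obtain ⟨N₂, hN₂⟩ := hG j hJ (w ++ [.app d]) (.label w c)
    obtain ⟨δ, hδ⟩ := Function.ne_iff.1 hzx
    let B := max (max N₁ N₂) (δ + 1)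
    obtain ⟨τ, hτ, hτB⟩ : ∃ τ ∈ P.fiberAt c y (G j x) z j,
        B < τ.length ∧ B < (read c τ).2.2.length := by
      by_contra! hcon
      have hinits : ∀ p, {τ | IsInit τ p ∧ τ.length ≤ B}.Finite := fun p =>
        ((Set.finite_Iic B).image (takeSeq p)).subset fun τ hτ => ⟨τ.length, hτ.2, hτ.1⟩
      have hlong : (P.fiberAt c y (G j x) z j ∩
          (fun τ => (read c τ).2.2) ⁻¹' {τ | IsInit τ (G j z) ∧ τ.length ≤ B}).Finite := by
        refine Set.Finite.of_finite_fibers (fun τ => (read c τ).2.2)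
          ((hinits (G j z)).subset ?_) fun τ₀ _ => (hvalue τ₀).subset ?_
        · rintro _ ⟨τ, hτ, rfl⟩
          exact hτ.2
        · rintro τ ⟨hτ, hτ₀⟩
          exact ⟨hτ.1, hτ₀⟩
      refine hinf (((hinits (G j x)).union hlong).subset fun τ hτ => ?_)
      rcases le_or_gt τ.length B with hB | hB
      · exact .inl ⟨hτ.1.1, hB⟩
      · exact .inr ⟨hτ, hread τ hτ, hcon τ hτ hB⟩
    have hB₁ : N₁ ≤ B := (le_max_left _ _).trans (le_max_left _ _)
    have hB₂ : N₂ ≤ B := (le_max_right _ _).trans (le_max_left _ _)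
    have hBδ : δ + 1 ≤ B := le_max_right _ _
    obtain ⟨m, hm⟩ : ∃ m, τ.length = m + 1 := Nat.exists_eq_add_one.2 (by omega)
    obtain ⟨n, hn⟩ : ∃ n, (read c τ).2.2.length = n + 1 := Nat.exists_eq_add_one.2 (by omega)
    have hτx : takeSeq (G j x) (m + 1) = τ := hm ▸ hτ.1.1
    have hτz : takeSeq (G j z) (n + 1) = (read c τ).2.2 := hn ▸ hread τ hτ
    rcases lt_trichotomy (rank x m) (rank z n) with hlt | heq | hlt
    · have := hN₁ z n (m + 1) (by omega) fun i hi => by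
        rw [hzx']
        exact ((rank_strictMono x).monotone (Nat.lt_succ_iff.1 hi)).trans_lt hlt
      rw [hzx', hτx] at this
      refine this.ne (pick_eq (p := G j z) ?_ ⟨_, rfl, by omega⟩)
      rintro _ rfl
      exact hread τ hτ
    · exact hδ ((eq_of_rank_eq heq).2 δ (by omega)).symm
    · have := hN₂ x m (n + 1) (by omega) fun i hi => by
        rw [hxz']
        exact ((rank_strictMono z).monotone (Nat.lt_succ_iff.1 hi)).trans_lt hlt
      rw [hxz', hτz] at this
      simp only [taskSet, hw, hxz'] at this
      refine this.ne (pick_eq (p := G j x) ?_ ⟨τ, ⟨hτ.2.1, hτ.2.2, rfl⟩, by omega⟩)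
      rintro σ ⟨hz, hj, hσ⟩
      exact hinit σ hz hj (hσ ▸ hread τ hτ)
  · obtain ⟨w', hw'⟩ := hyx j hj.le
    have hzx' : P.word (trunc j G) (.app e :: w') z = x := by
      rw [← hw', ← he]
      rfl
    have hzy' : P.word (trunc j G) [.app e] z = y := he
    refine Set.Infinite.mono (t := {τ' | ∃ τ, (IsInit τ (G J x) ∧ P.Ok y (read c τ)) ∧
      P.tail y (read c τ).1 = z ∧ (read c τ).2.1 = j ∧ (read c τ).2.2 = τ'}) ?_ hlabels
      ((hG j (hJ.trans hj) (.app e :: w') (.preimage [.app e] c J)).not_infinite (x := z) ?_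
        (by simp only [taskSet, hzx', hzy', trunc_of_lt G hj]))
    · rintro _ ⟨τ, hτ, rfl⟩
      exact ⟨τ, hτ.1, hτ.2.1, hτ.2.2, rfl⟩
    · rintro _ ⟨τ, hok, hz, hj, rfl⟩
      exact hread τ ⟨hok, hz, hj⟩

end Reads

end Frame

/-- The index to which the code `c.1.1` reduces the index of the initial segment `τ` at stage
`c.1.2` in the real with number `c.2`. -/
noncomputable def readBy (c : (Nat.Partrec.Code × ℕ) × ℕ) (τ : List ℕ) : Index :=
  Denumerable.ofNat Index
    ((c.1.1.eval (Nat.pair c.2 (Encodable.encode (([], c.1.2, τ) : Index)))).getOrElse 0)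

theorem exists_readBy_eq {ρ : ℕ → ℕ} (hρ : Computable ρ) : ∃ e, ∀ J i τ,
    readBy ((e, J), i) τ =
      Denumerable.ofNat Index (ρ (Nat.pair i (Encodable.encode (([], J, τ) : Index)))) := by
  obtain ⟨e, he⟩ := Nat.Partrec.Code.exists_code.1 (Partrec.nat_iff.1 hρ.partrec)
  refine ⟨e, fun J i τ => ?_⟩
  simp only [readBy, he]
  exact congrArg _ (dif_pos trivial)

namespace Frame

section Coded

variable {C : Type} {read : C × ℕ → List ℕ → Index} (P : Frame read)
  {G : ℕ → (ℕ → Bool) → ℕ → ℕ}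

/-- The real assigned to `x`. -/
noncomputable def coded (G : ℕ → (ℕ → Bool) → ℕ → ℕ) (x : ℕ → Bool) : ℕ → Bool :=
  fun u => decide (P.Val G x (Denumerable.ofNat Index u))

theorem coded_eq_coded {x y : ℕ → Bool} {u v : ℕ} : P.coded G x u = P.coded G y v ↔
    (P.Val G x (Denumerable.ofNat Index u) ↔ P.Val G y (Denumerable.ofNat Index v)) :=
  decide_eq_decide

theorem val_root {J : ℕ} (hJ : J ∈ P.Q) (x : ℕ → Bool) (τ : List ℕ) :
    P.Val G x ([], J, τ) ↔ ¬ IsInit τ (G J x) :=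
  and_iff_right ⟨trivial, hJ⟩

theorem measurable_coded (hG : ∀ j, Measurable (G j)) : Measurable (P.coded G) :=
  measurable_pi_lambda _ fun _ => measurable_decide (measurable_val hG _)

theorem coded_injective (h0 : ∀ x k, G 0 x k = (x k).toNat) :
    Function.Injective (P.coded G) := by
  intro x y hxy
  funext n
  have h := P.coded_eq_coded.1
    (congrFun hxy (Encodable.encode (([], 0, takeSeq (G 0 x) (n + 1)) : Index)))
  rw [Denumerable.ofNat_encode, P.val_root P.zero_mem_Q, P.val_root P.zero_mem_Q,
    not_iff_not] at h
  have := (h.1 (isInit_takeSeq _ _)).getD (m := n) (by simp)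
  rw [getD_takeSeq _ n.lt_succ_self, h0, h0] at this
  revert this
  cases x n <;> cases y n <;> simp

theorem oneLE_coded {x y : ℕ → Bool} (h : TuringEquiv x y) :
    OneLE (P.coded G x) (P.coded G y) := by
  have hyx := P.equivalence.symm h
  obtain ⟨d, rfl⟩ := P.exists_φ y x hyx
  obtain ⟨m, hm⟩ := (P.equiv_iff _ _).1 hyx
  obtain ⟨n, hn, hmn⟩ := P.infinite_Q.exists_gt m
  refine ⟨fun u => Encodable.encode (((n, d) :: (Denumerable.ofNat Index u).1,
    (Denumerable.ofNat Index u).2) : Index), ?_, fun u v huv => ?_, fun u => ?_⟩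
  · have h1 : Primrec fun u : ℕ => Denumerable.ofNat Index u := Primrec.ofNat _
    exact (Primrec.encode.comp (Primrec.pair (Primrec.list_cons.comp
      (Primrec.const (n, d)) (Primrec.fst.comp h1)) (Primrec.snd.comp h1))).to_comp
  · have h1 := Encodable.encode_injective huv
    rw [Prod.mk.injEq, List.cons.injEq] at h1
    have h2 := Prod.ext h1.1.2 h1.2
    rw [← Denumerable.encode_ofNat (α := Index) u, h2, Denumerable.encode_ofNat]
  · rw [P.coded_eq_coded, Denumerable.ofNat_encode]
    have hF := P.mono_F _ _ _ _ hmn.le hm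
    simp only [Val, Ok, Valid, hn, hF, true_and]
    rfl

end Coded

section Reductions

variable {P : Frame readBy} {G : ℕ → (ℕ → Bool) → ℕ → ℕ}

theorem exists_reads_of_joinSeq {xs : ℕ → ℕ → Bool} {y : ℕ → Bool}
    (h : MLE (joinSeq fun i => P.coded G (xs i)) (P.coded G y)) :
    ∃ e, ∀ J ∈ P.Q, ∀ i, P.Reads G ((e, J), i) y (G J (xs i)) := by
  obtain ⟨ρ, hρ, hf⟩ := h
  obtain ⟨e, he⟩ := exists_readBy_eq hρ
  refine ⟨e, fun J hJ i τ => ?_⟩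
  have := hf (Nat.pair i (Encodable.encode (([], J, τ) : Index)))
  rw [joinSeq, Nat.unpair_pair, P.coded_eq_coded, Denumerable.ofNat_encode,
    P.val_root hJ, ← he J i τ] at this
  exact this

theorem exists_reads {x y : ℕ → Bool} (h : MLE (P.coded G x) (P.coded G y)) :
    ∃ e, ∀ J ∈ P.Q, P.Reads G ((e, J), 0) y (G J x) := by
  obtain ⟨ρ, hρ, hf⟩ := h
  obtain ⟨e, he⟩ := exists_reads_of_joinSeq (xs := fun _ => x) (P := P) (G := G) (y := y)
    ⟨fun n => ρ n.unpair.2, hρ.comp (Primrec.snd.comp Primrec.unpair).to_comp, fun n => hf _⟩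
  exact ⟨e, fun J hJ => he J hJ 0⟩

theorem turingEquiv_of_mEquiv (h0 : ∀ x k, G 0 x k = (x k).toNat)
    (hG : ∀ J, 0 < J → ∀ w T,
      Dominates (G J) (P.word (trunc J G) w) (P.taskSet (trunc J G) J w T))
    {x y : ℕ → Bool} (h : MEquiv (P.coded G x) (P.coded G y)) : TuringEquiv x y := by
  obtain ⟨e, he⟩ := exists_reads h.1
  obtain ⟨e', he'⟩ := exists_reads h.2
  obtain ⟨b, J₁, hb⟩ := (he 0 P.zero_mem_Q).exists_act (h0 x)
  obtain ⟨b', J₂, hb'⟩ := (he' 0 P.zero_mem_Q).exists_act (h0 y)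
  obtain ⟨J, hJ, hlt⟩ := P.infinite_Q.exists_gt (max J₁ J₂)
  have hJ₁ : J₁ ≤ J := (le_max_left _ _).trans hlt.le
  have hJ₂ : J₂ ≤ J := (le_max_right _ _).trans hlt.le
  obtain ⟨hfin, hfiber⟩ := (he J hJ).eq_of_infinite (Nat.zero_lt_of_lt hlt) hG
    (fun J' hJ' => ⟨[b'], hb' J' (hJ₂.trans hJ')⟩) (fun J' hJ' => ⟨[b], hb J' (hJ₁.trans hJ')⟩)
  obtain ⟨z, j, hinf⟩ := exists_infinite_fiberAt hfin (G J x)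
  obtain ⟨τ, hτ⟩ := hinf.nonempty
  rw [hfiber z j hinf] at hτ
  exact P.equivalence.symm (hτ.2.1 ▸ equiv_tail y _)

theorem not_mLE_joinSeq
    (hG : ∀ J, 0 < J → ∀ w T,
      Dominates (G J) (P.word (trunc J G) w) (P.taskSet (trunc J G) J w T))
    {x : ℕ → Bool} {xs : ℕ → ℕ → Bool} (hxs : Function.Injective xs)
    (hE : ∀ i, TuringEquiv (xs i) x) :
    ¬ MLE (joinSeq fun i => P.coded G (xs i)) (P.coded G x) := by
  intro h
  obtain ⟨e, he⟩ := exists_reads_of_joinSeq h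
  obtain ⟨J, hJ, hpos⟩ := P.infinite_Q.exists_gt 0
  have hkey : ∀ i, (P.badSet ((e, J), i) x).Finite ∧
      ∀ z j, (P.fiberAt ((e, J), i) x (G J (xs i)) z j).Infinite → z = xs i := by
    intro i
    obtain ⟨d, hd⟩ := P.exists_φ _ _ (hE i)
    obtain ⟨d', hd'⟩ := P.exists_φ _ _ (P.equivalence.symm (hE i))
    exact (he J hJ i).eq_of_infinite hpos hG (fun _ _ => ⟨[.app d], hd⟩)
      fun _ _ => ⟨[.app d'], hd'⟩
  have hok : ∀ i {S : Set (List ℕ)}, S.Infinite →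
      ∃ τ ∈ S, P.Ok x (readBy ((e, J), i) τ) := by
    intro i S hS
    obtain ⟨τ, hτ, hn⟩ := (hS.sdiff (hkey i).1).nonempty
    exact ⟨τ, hτ, not_not.1 hn⟩
  obtain ⟨M, hM⟩ := (P.finite_recurrentTop (e, J) fun n i hinf => by
    obtain ⟨τ, rfl, hτ⟩ := hok i hinf
    exact hτ.1.topStep_mem).bddAbove
  have hfin := P.finite_recurrent M (e, J) x fun z i hinf => by
    by_contra hz
    refine hinf (Set.Finite.of_finite_fibers (fun τ => topStep (readBy ((e, J), i) τ).1)
      ((finite_range_of_finite_badSet (hkey i).1).2.subset (Set.image_subset_range _ _))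
      fun n _ => ?_)
    by_contra hn
    obtain ⟨τ, ⟨rfl, rfl⟩, hτ⟩ := hok i hn
    exact hz (P.mono_F _ _ _ _ (hM ⟨i, Set.Infinite.mono (fun _ h => h.2) hn⟩) hτ.1.F_topStep)
  refine Set.infinite_range_of_injective hxs (hfin.subset ?_)
  rintro _ ⟨i, rfl⟩
  obtain ⟨z, j, hinf⟩ := exists_infinite_fiberAt (hkey i).1 (G J (xs i))
  exact ⟨i, (hinf.mono fun τ hτ => hτ.2.1.trans ((hkey i).2 z j hinf))⟩

end Reductions

end Frame

/-- Suppose Turing equivalence on `2^ω` is hyper-recursively-finite. Then there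
exists an injective Borel function `f : 2^ω → 2^ω` such that: `x_0 ≡_T x_1` implies
`f(x_0) ≡₁ f(x_1)`; `¬(x_0 ≡_T x_1)` implies `¬(f(x_0) ≡_m f(x_1))`; and for every
`x` there is no infinite sequence `(x_i)` of distinct reals with `x_i ≡_T x` for all
`i` and `f(x) ≥_m ⊕_i f(x_i)`. In particular, `f` is a Borel homomorphism from
`≡_T` to `≡_m` which is not uniformly `(≡_T, ≡_m)`-invariant. -/
theorem nonuniform_homomorphism_of_hyperRecFin (h : HyperRecFin) :
    ∃ f : (ℕ → Bool) → ℕ → Bool, Measurable f ∧ Function.Injective f ∧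
      (∀ x₀ x₁, TuringEquiv x₀ x₁ → OneEquiv (f x₀) (f x₁)) ∧
      (∀ x₀ x₁, ¬ TuringEquiv x₀ x₁ → ¬ MEquiv (f x₀) (f x₁)) ∧
      (∀ x, ¬ ∃ xs : ℕ → ℕ → Bool, Function.Injective xs ∧
        (∀ i, TuringEquiv (xs i) x) ∧ MLE (joinSeq fun i => f (xs i)) (f x)) := by
  obtain ⟨P⟩ := h.nonempty_frame readBy
  obtain ⟨G, hGm, h0, hG⟩ := P.exists_hierarchy
  refine ⟨P.coded G, P.measurable_coded hGm, P.coded_injective h0, fun x₀ x₁ hx => ?_,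
    fun x₀ x₁ hx hf => hx (Frame.turingEquiv_of_mEquiv h0 hG hf), ?_⟩
  · exact ⟨P.oneLE_coded hx, P.oneLE_coded (P.equivalence.symm hx)⟩
  · rintro x ⟨xs, hxs, hE, hle⟩
    exact Frame.not_mLE_joinSeq hG hxs hE hle

end SlamanSteel
end
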